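/- Let q be an odd prime power such that q−1 has at least 14 distinct prime divisors (ω(q−1) ≥ 14). Then 𝔽_q contains three consecutive primitive elements. -/

import Mathlib

open Finset

/-- An element `g` of a finite field is primitive if it generates the multiplicative
group of nonzero elements, i.e. every nonzero element is a power of `g`. -/
def IsPrimitiveElem {F : Type*} [Field F] (g : F) : Prop :=
  ∀ x : F, x ≠ 0 → ∃ k : ℕ, g ^ k = x

/-- The field `F` contains `n` consecutive distinct primitive elements: there is `g`
such that `g, g+1, …, g+n-1` are `n` distinct primitive elements. -/
def HasConsecutivePrimitives (F : Type*) [Field F] (n : ℕ) : Prop :=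
  ∃ g : F, (∀ k : ℕ, k < n → IsPrimitiveElem (g + (k : F))) ∧
    ∀ i : ℕ, i < n → ∀ j : ℕ, j < n → g + (i : F) = g + (j : F) → i = j

open Polynomial in
theorem Polynomial.natDegree_resultant_le {R : Type*} [CommRing R] (f g : R[X][X]) (m n a b : ℕ)
    (hf : ∀ i, (f.coeff i).natDegree ≤ a) (hg : ∀ i, (g.coeff i).natDegree ≤ b) :
    (resultant f g m n).natDegree ≤ m * b + n * a := by
  have key : ∀ i j : Fin (m + n), (sylvester f g m n i j).natDegree ≤
      (Fin.addCases (fun _ => b) (fun _ => a) j : ℕ) := by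
    intro i j
    refine Fin.addCases (fun j => ?_) (fun j => ?_) j
    · simp only [sylvester, Matrix.of_apply, Fin.addCases_left]
      split_ifs
      · exact hg _
      · simp
    · simp only [sylvester, Matrix.of_apply, Fin.addCases_right]
      split_ifs
      · exact hf _
      · simp
  rw [resultant, Matrix.det_apply]
  refine natDegree_sum_le_of_forall_le _ _ fun σ _ => ?_
  refine (natDegree_smul_le _ _).trans ((natDegree_prod_le _ _).trans ?_)
  refine (Finset.sum_le_sum fun j _ => key (σ j) j).trans ?_
  simp [Fin.sum_univ_add]

open Polynomial in
/-- If `h` is not an `s`-th power for any divisor `s > 1` of `d` and `K` contains the `d`-th roots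
of unity, then `X ^ d - h` is irreducible. -/
theorem irreducible_X_pow_sub_C_of_isPrimitiveRoot {K : Type*} [Field K] {d : ℕ} (hd : 0 < d)
    {ζ : K} (hζ : IsPrimitiveRoot ζ d) {h : K} (hh : ∀ s, s ∣ d → 1 < s → ∀ z, z ^ s ≠ h) :
    Irreducible (X ^ d - C h) := by
  have hP0 : (X ^ d - C h : K[X]) ≠ 0 := X_pow_sub_C_ne_zero hd h
  have hPu : ¬ IsUnit (X ^ d - C h : K[X]) := by
    intro hu
    have := natDegree_eq_zero_of_isUnit hu
    rw [natDegree_X_pow_sub_C] at this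
    omega
  obtain ⟨p, hp, hpd⟩ := WfDvdMonoid.exists_irreducible_factor hPu hP0
  set L := AlgebraicClosure K
  obtain ⟨t, ht⟩ := IsAlgClosed.exists_pow_nat_eq (algebraMap K L h) hd
  have hζ' : IsPrimitiveRoot (algebraMap K L ζ) d := hζ.map_of_injective (algebraMap K L).injective
  -- all roots of `p` in `L` are of the form `ζ ^ i * t`
  set p' := (p * C p.leadingCoeff⁻¹) with hp'
  have hmon : p'.Monic := monic_mul_leadingCoeff_inv hp.ne_zero
  have hp'd : p' ∣ X ^ d - C h := by
    have : Associated p p' := ⟨Units.mk (C p.leadingCoeff⁻¹) (C p.leadingCoeff)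
      (by rw [← C_mul, inv_mul_cancel₀ (leadingCoeff_ne_zero.2 hp.ne_zero), C_1])
      (by rw [← C_mul, mul_inv_cancel₀ (leadingCoeff_ne_zero.2 hp.ne_zero), C_1]), rfl⟩
    exact this.symm.dvd.trans hpd
  have hdeg : p'.natDegree = p.natDegree := natDegree_mul_leadingCoeff_inv p hp.ne_zero
  set e := p.natDegree with he
  have hroots : ∀ r ∈ (p'.map (algebraMap K L)).roots, ∃ i, r = algebraMap K L (ζ ^ i) * t := by
    intro r hr
    have h1 : r ^ d = algebraMap K L h := by
      have h2 : aeval r p' = 0 := by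
        have := (mem_roots (hmon.map (algebraMap K L)).ne_zero).1 hr
        simpa [IsRoot, eval_map_algebraMap] using this
      have := aeval_eq_zero_of_dvd_aeval_eq_zero hp'd h2
      simpa [sub_eq_zero] using this
    by_cases h0 : t = 0
    · have : r = 0 := by
        rw [← ht, h0, zero_pow hd.ne'] at h1
        exact pow_eq_zero_iff hd.ne' |>.1 h1
      exact ⟨0, by simp [this, h0]⟩
    · have : NeZero d := ⟨hd.ne'⟩
      obtain ⟨i, -, hi⟩ := hζ'.eq_pow_of_pow_eq_one (ξ := r / t) (by
        rw [div_pow, h1, ht, div_self]; rw [← ht]; exact pow_ne_zero _ h0)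
      exact ⟨i, by rw [map_pow, hi, div_mul_cancel₀ _ h0]⟩
  have hprod : ∀ s : Multiset L, (∀ r ∈ s, ∃ i, r = algebraMap K L (ζ ^ i) * t) →
      ∃ i, s.prod = algebraMap K L (ζ ^ i) * t ^ s.card := by
    intro s
    induction s using Multiset.induction with
    | empty => intro _; exact ⟨0, by simp⟩
    | cons a s ih =>
      intro H
      obtain ⟨i, hi⟩ := ih fun r hr => H r (Multiset.mem_cons_of_mem hr)
      obtain ⟨j, hj⟩ := H a (Multiset.mem_cons_self _ _)
      refine ⟨i + j, ?_⟩
      rw [Multiset.prod_cons, hi, hj, Multiset.card_cons, pow_add, map_mul]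
      ring
  obtain ⟨i, hi⟩ := hprod _ hroots
  have hsplit := IsAlgClosed.splits (p'.map (algebraMap K L))
  have hcard : (p'.map (algebraMap K L)).roots.card = e := by
    rw [← hsplit.natDegree_eq_card_roots, natDegree_map, hdeg]
  rw [hcard] at hi
  have hζ0 : ζ ≠ 0 := hζ.ne_zero hd.ne'
  obtain ⟨c, hc⟩ : ∃ c : K, t ^ e = algebraMap K L c := by
    have h3 := hsplit.coeff_zero_eq_prod_roots_of_monic (hmon.map (algebraMap K L))
    rw [hi, coeff_map] at h3
    refine ⟨(ζ ^ i)⁻¹ * ((-1) ^ (p'.map (algebraMap K L)).natDegree * p'.coeff 0), ?_⟩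
    rw [map_mul, map_mul, h3, map_inv₀]
    have h5 : algebraMap K L (ζ ^ i) ≠ 0 := by simp [hζ0]
    have h6 : ((-1 : L) ^ (p'.map (algebraMap K L)).natDegree) ^ 2 = 1 := by
      rw [← pow_mul, mul_comm, pow_mul]; simp
    simp only [map_pow, map_neg, map_one]
    rw [← mul_assoc ((-1 : L) ^ _) , ← sq, h6, one_mul, ← map_pow, inv_mul_cancel_left₀ h5]
  have he0 : 0 < e := hp.natDegree_pos
  -- so does `t ^ gcd e d`
  have hgcd : ∃ c : K, t ^ Nat.gcd e d = algebraMap K L c := by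
    by_cases h0 : t = 0
    · exact ⟨0, by simp [h0, (Nat.gcd_pos_of_pos_left d he0).ne']⟩
    · have h1 := Nat.gcd_eq_gcd_ab e d
      refine ⟨c ^ (Nat.gcdA e d) * h ^ (Nat.gcdB e d), ?_⟩
      rw [map_mul, map_zpow₀, map_zpow₀, ← hc, ← ht, ← zpow_natCast t (Nat.gcd e d), h1,
        zpow_add₀ h0, zpow_mul, zpow_mul, zpow_natCast, zpow_natCast]
  obtain ⟨z, hz⟩ := hgcd
  have hgd : Nat.gcd e d ∣ d := Nat.gcd_dvd_right e d
  have hdz : z ^ (d / Nat.gcd e d) = h := by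
    apply (algebraMap K L).injective
    rw [map_pow, ← hz, ← pow_mul, Nat.mul_div_cancel' hgd, ht]
  have : ¬ 1 < d / Nat.gcd e d := fun h1 => hh _ (Nat.div_dvd_of_dvd hgd) h1 z hdz
  have hed : d ∣ e := by
    have h2 : d / Nat.gcd e d * Nat.gcd e d = d := Nat.div_mul_cancel hgd
    have h3 : d / Nat.gcd e d = 1 := by
      have : 0 < d / Nat.gcd e d := Nat.div_pos (Nat.le_of_dvd hd hgd) (Nat.gcd_pos_of_pos_right e hd)
      omega
    rw [h3, one_mul] at h2
    rw [← h2]; exact Nat.gcd_dvd_left e d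
  obtain ⟨k, hk⟩ := hpd
  have hk0 : k ≠ 0 := by rintro rfl; simp [hP0] at hk
  have h4 := congrArg natDegree hk
  rw [natDegree_X_pow_sub_C, natDegree_mul hp.ne_zero hk0] at h4
  have h5 : k.natDegree = 0 := by have := Nat.le_of_dvd he0 hed; omega
  rw [hk]
  have hku : IsUnit k := by
    rw [isUnit_iff_degree_eq_zero, degree_eq_natDegree hk0, h5]; rfl
  exact (irreducible_mul_isUnit hku).2 hp

open Polynomial in
/-- The substitution `Y ↦ X ^ Q` on bivariate polynomials (outer variable `X`) is injective
on polynomials of `X`-degree less than `Q`. -/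
theorem Polynomial.eq_zero_of_eval₂_expand_eq_zero {R : Type*} [CommRing R] {Q : ℕ} {D : R[X][X]}
    (hD : D.natDegree < Q) (h : D.eval₂ (expand R Q : R[X] →+* R[X]) X = 0) : D = 0 := by
  have hQ : 0 < Q := by omega
  ext i k
  by_cases hi : D.natDegree < i
  · simp [coeff_eq_zero_of_natDegree_lt hi]
  rw [eval₂_eq_sum_range' _ hD] at h
  have h1 := congrArg (fun p => coeff p (k * Q + i)) h
  simp only [finsetSum_coeff, coeff_zero, coeff_mul_X_pow', RingHom.coe_coe] at h1
  rw [Finset.sum_eq_single i] at h1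
  · simpa [coeff_expand_mul hQ] using h1
  · intro j hj hji
    rw [Finset.mem_range] at hj
    split_ifs with hle
    · rw [coeff_expand hQ, if_neg]
      intro hdvd
      have hi' : i < Q := by omega
      have h2 : (k * Q + i - j + j) % Q = j % Q := by
        rw [Nat.add_mod, Nat.mod_eq_zero_of_dvd hdvd]; simp
      rw [Nat.sub_add_cancel hle, Nat.mul_add_mod', Nat.mod_eq_of_lt hi', Nat.mod_eq_of_lt hj] at h2
      exact hji h2.symm
    · rfl
  · intro h2
    exact absurd (Finset.mem_range.2 (by omega)) h2

open Polynomial in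
theorem Polynomial.rootMultiplicity_pow_eq {R : Type*} [CommRing R] [IsDomain R] (w : R[X]) (c : R)
    (s : ℕ) : rootMultiplicity c (w ^ s) = s * rootMultiplicity c w := by
  classical
  rw [← count_roots, roots_pow, Multiset.count_nsmul, count_roots]

open Polynomial in
theorem irreducible_C_mul_X_pow_sub_C_fractionRing {F : Type*} [Field F] {f : F[X]} (hf : f ≠ 0)
    {d : ℕ} (hd : 0 < d) {ζ : F} (hζ : IsPrimitiveRoot ζ d)
    (hmult : ∀ s, s ∣ d → 1 < s → ∃ c, ¬ s ∣ f.rootMultiplicity c)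
    (k : Type*) [Field k] [Algebra F[X][X] k] [IsFractionRing F[X][X] k] :
    Irreducible ((C (f.map C) * X ^ d - C (C f) : F[X][X][X]).map
      (algebraMap F[X][X] k)) := by
  have hinj : Function.Injective (algebraMap F[X][X] k) := IsFractionRing.injective _ _
  have hfx : (f.map C : F[X][X]) ≠ 0 := (Polynomial.map_ne_zero_iff C_injective).2 hf
  have ha : algebraMap F[X][X] k (f.map C) ≠ 0 := by
    rwa [Ne, map_eq_zero_iff _ hinj]
  set h : k := algebraMap F[X][X] k (C f) / algebraMap F[X][X] k (f.map C) with hh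
  have heq : (C (f.map C) * X ^ d - C (C f) : F[X][X][X]).map (algebraMap F[X][X] k) =
      C (algebraMap F[X][X] k (f.map C)) * (X ^ d - C h) := by
    rw [mul_sub, ← C_mul, hh, mul_div_cancel₀ _ ha]
    simp
  rw [heq]
  refine (irreducible_isUnit_mul (isUnit_C.2 (isUnit_iff_ne_zero.2 ha))).2 ?_
  refine irreducible_X_pow_sub_C_of_isPrimitiveRoot hd
    (hζ.map_of_injective (f := (algebraMap F[X][X] k).comp ((C : F[X] →+* F[X][X]).comp C)) ?_) ?_
  · exact hinj.comp (C_injective.comp C_injective)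
  · intro s hs hs1 z hz
    obtain ⟨c, hc⟩ := hmult s hs hs1
    obtain ⟨u, v, hv, rfl⟩ := IsFractionRing.div_surjective (A := F[X][X]) z
    have hv0 : v ≠ 0 := nonZeroDivisors.ne_zero hv
    have hva : algebraMap F[X][X] k v ≠ 0 := by rwa [Ne, map_eq_zero_iff _ hinj]
    have h1 : u ^ s * f.map C = C f * v ^ s := by
      apply hinj
      rw [hh, div_pow, div_eq_div_iff (pow_ne_zero _ hva) ha] at hz
      simpa using hz
    have hCf : (C f : F[X][X]) ≠ 0 := C_ne_zero.2 hf
    have hr : (C f : F[X][X]) * v ^ s ≠ 0 := mul_ne_zero hCf (pow_ne_zero _ hv0)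
    have hl : u ^ s * f.map C ≠ 0 := by rwa [h1]
    have h2 := congrArg (rootMultiplicity (C c)) h1
    rw [rootMultiplicity_mul hl, rootMultiplicity_mul hr, rootMultiplicity_pow_eq,
      rootMultiplicity_pow_eq, rootMultiplicity_C, zero_add,
      ← eq_rootMultiplicity_map C_injective] at h2
    exact hc ((Nat.dvd_add_right (Nat.dvd_mul_right s _)).1 (by rw [h2]; exact Nat.dvd_mul_right s _))

open Polynomial in
/-- Independence of the powers of `f ^ ((Q - 1) / d)` over bivariate polynomials in `X`, `X ^ Q` of
small degree in `X`. -/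
theorem eq_zero_of_sum_eval₂_expand_mul_pow_eq_zero {F : Type*} [Field F] [Fintype F] {f : F[X]}
    (hf : f ≠ 0) {d m : ℕ} (hd : 0 < d) (hdm : d * m + 1 = Fintype.card F)
    {ζ : F} (hζ : IsPrimitiveRoot ζ d)
    (hmult : ∀ s, s ∣ d → 1 < s → ∃ c, ¬ s ∣ f.rootMultiplicity c) {b : ℕ}
    (hb : d * b + (d - 1) * f.natDegree < Fintype.card F) (e : ℕ → F[X][X])
    (he : ∀ j, (e j).natDegree ≤ b)
    (h : ∑ j ∈ Finset.range d, (e j).eval₂ (expand F (Fintype.card F) : F[X] →+* F[X]) X *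
      (f ^ m) ^ j = 0) : ∀ j < d, e j = 0 := by
  set Q := Fintype.card F
  set φ : F[X][X] →+* F[X] := eval₂RingHom (expand F Q : F[X] →+* F[X]) X with hφ
  set P : F[X][X][X] := ∑ j ∈ Finset.range d, C (e j) * X ^ j with hP
  set H : F[X][X][X] := C (f.map C) * X ^ d - C (C f) with hH
  have hPc : ∀ j, P.coeff j = if j < d then e j else 0 := by
    intro j
    simp [hP, finsetSum_coeff, coeff_C_mul, coeff_X_pow]
  suffices hP0 : P = 0 by
    intro j hj
    have := hPc j
    rw [hP0, if_pos hj] at this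
    simpa using this.symm
  have hfx : (f.map C : F[X][X]) ≠ 0 := (Polynomial.map_ne_zero_iff C_injective).2 hf
  have hPd : P.natDegree < d := by
    have : P.degree < d := by
      rw [degree_lt_iff_coeff_zero]
      intro j hj
      rw [hPc, if_neg (by omega)]
    by_cases h0 : P = 0
    · simp [h0, hd]
    · exact (natDegree_lt_iff_degree_lt h0).2 this
  have hHd : H.natDegree = d := by
    rw [hH, natDegree_sub_C, natDegree_C_mul_X_pow _ _ hfx]
  set r := f.natDegree
  have hHc : ∀ i, (H.coeff i).natDegree ≤ r := by
    intro i
    rw [hH, coeff_sub, coeff_C_mul, coeff_X_pow, coeff_C]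
    refine (natDegree_sub_le _ _).trans (max_le ?_ ?_)
    · split_ifs
      · rw [mul_one]; exact natDegree_map_le
      · simp
    · split_ifs <;> simp
  have hPc' : ∀ i, (P.coeff i).natDegree ≤ b := by
    intro i
    rw [hPc]; split_ifs
    · exact he i
    · simp
  have hres : resultant P H = 0 := by
    refine eq_zero_of_eval₂_expand_eq_zero (Q := Q) ?_ ?_
    · refine lt_of_le_of_lt (natDegree_resultant_le P H _ _ b r hPc' hHc) ?_
      rw [hHd]
      have : P.natDegree * r ≤ (d - 1) * r := Nat.mul_le_mul_right _ (by omega)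
      omega
    · obtain ⟨p, q, -, -, hpq⟩ := exists_mul_add_mul_eq_C_resultant P H le_rfl le_rfl
        (Or.inr (by omega))
      have h1 := congrArg (eval₂ φ (f ^ m)) hpq
      rw [eval₂_C, eval₂_add, eval₂_mul, eval₂_mul] at h1
      have h2 : eval₂ φ (f ^ m) P = 0 := by
        rw [hP, eval₂_finsetSum, ← h]
        refine Finset.sum_congr rfl fun j _ => ?_
        rw [eval₂_mul, eval₂_C, eval₂_X_pow, hφ, coe_eval₂RingHom]
      have h3 : eval₂ φ (f ^ m) H = 0 := by
        have h4 : φ (f.map C) = f := by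
          rw [hφ, coe_eval₂RingHom, eval₂_map]
          have : ((expand F Q : F[X] →+* F[X]).comp C) = C := by ext; simp
          rw [this, eval₂_C_X]
        have h5 : φ (C f) = f ^ Q := by
          rw [hφ, coe_eval₂RingHom, eval₂_C]
          exact FiniteField.expand_card f
        rw [hH, eval₂_sub, eval₂_mul, eval₂_C, eval₂_C, eval₂_X_pow, h4, h5, ← hdm, ← pow_mul,
          mul_comm m d, pow_succ, mul_comm, sub_self]
      rw [h2, h3, zero_mul, zero_mul, zero_add] at h1
      exact h1.symm
  set k := FractionRing F[X][X]
  have hinj : Function.Injective (algebraMap F[X][X] k) := IsFractionRing.injective _ _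
  have hirr := irreducible_C_mul_X_pow_sub_C_fractionRing hf hd hζ hmult k
  have hres' : resultant (P.map (algebraMap F[X][X] k)) (H.map (algebraMap F[X][X] k)) = 0 := by
    rw [natDegree_map_eq_of_injective hinj, natDegree_map_eq_of_injective hinj, resultant_map_map,
      hres, map_zero]
  have hnc := (resultant_eq_zero_iff.1 hres').2
  rw [isCoprime_comm, hirr.coprime_iff_not_dvd, not_not] at hnc
  by_contra hP0
  have h6 : P.map (algebraMap F[X][X] k) ≠ 0 := (Polynomial.map_ne_zero_iff hinj).2 hP0
  have h7 := natDegree_le_of_dvd hnc h6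
  rw [natDegree_map_eq_of_injective hinj, natDegree_map_eq_of_injective hinj, hHd] at h7
  omega

open Polynomial in
theorem Polynomial.pow_dvd_hasseDeriv_pow_mul {R : Type*} [CommRing R] (f e : R[X]) (N : ℕ) :
    ∀ l, f ^ (N - l) ∣ hasseDeriv l (f ^ N * e) := by
  induction N with
  | zero => simp
  | succ N ih =>
    intro l
    rw [pow_succ', mul_assoc, hasseDeriv_mul]
    refine Finset.dvd_sum fun ij hij => ?_
    rw [Finset.HasAntidiagonal.mem_antidiagonal] at hij
    obtain ⟨i, j⟩ := ij
    simp only at hij ⊢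
    rcases Nat.eq_zero_or_pos i with rfl | hi
    · rw [hasseDeriv_zero']
      refine (pow_dvd_pow f (show N + 1 - l ≤ N - j + 1 by omega)).trans ?_
      rw [pow_succ']
      exact mul_dvd_mul_left f (ih j)
    · exact ((pow_dvd_pow f (by omega)).trans (ih j)).mul_left _

open Polynomial in
theorem Polynomial.exists_hasseDeriv_pow_mul_X_pow {F : Type*} [Field F] {f : F[X]} (hf : f ≠ 0)
    (N l b : ℕ) (hl : l ≤ N) : ∃ E : F[X], f ^ (N - l) * E = hasseDeriv l (f ^ N * X ^ b) ∧
      E.natDegree ≤ b + l * f.natDegree := by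
  obtain ⟨E, hE⟩ := pow_dvd_hasseDeriv_pow_mul f (X ^ b) N l
  refine ⟨E, hE.symm, ?_⟩
  by_cases h0 : E = 0
  · simp [h0]
  have h1 := congrArg natDegree hE
  rw [natDegree_mul (pow_ne_zero _ hf) h0, natDegree_pow] at h1
  have h2 := (natDegree_hasseDeriv_le (f ^ N * X ^ b) l).trans (Nat.sub_le _ _)
  rw [natDegree_mul (pow_ne_zero _ hf) (pow_ne_zero _ X_ne_zero), natDegree_pow,
    natDegree_X_pow, h1] at h2
  have h3 : N * f.natDegree = (N - l) * f.natDegree + l * f.natDegree := by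
    rw [← add_mul, Nat.sub_add_cancel hl]
  omega

open Polynomial in
theorem Polynomial.hasseDeriv_X_pow_mul_eq_zero {R : Type*} [CommRing R] {p : ℕ} [Fact p.Prime]
    [CharP R p] (n k : ℕ) {j : ℕ} (hj0 : 0 < j) (hj : j < p ^ n) :
    hasseDeriv j (X ^ (p ^ n * k) : R[X]) = 0 := by
  have hQ : 0 < p ^ n := by omega
  have h1 : (((p ^ n * k).choose j : ℕ) : R) = 0 := by
    rw [← coeff_one_add_X_pow R, pow_mul, add_pow_char_pow, one_pow]
    have : (1 + X ^ p ^ n : R[X]) ^ k = expand R (p ^ n) ((1 + X) ^ k) := by simp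
    rw [this, coeff_expand hQ, if_neg]
    exact fun h => absurd (Nat.le_of_dvd hj0 h) (by omega)
  rw [← monomial_one_right_eq_X_pow, hasseDeriv_monomial, h1]
  simp

open Polynomial in
theorem Polynomial.hasseDeriv_mul_X_pow_mul {R : Type*} [CommRing R] {p : ℕ} [Fact p.Prime]
    [CharP R p] (g : R[X]) (n k : ℕ) {l : ℕ} (hl : l < p ^ n) :
    hasseDeriv l (g * X ^ (p ^ n * k)) = hasseDeriv l g * X ^ (p ^ n * k) := by
  rw [hasseDeriv_mul, Finset.sum_eq_single (l, 0)]
  · simp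
  · rintro ⟨i, j⟩ hij hne
    rw [Finset.HasAntidiagonal.mem_antidiagonal] at hij
    simp only at hij ⊢
    rw [hasseDeriv_X_pow_mul_eq_zero n k (Nat.pos_of_ne_zero ?_) (by omega), mul_zero]
    rintro rfl
    exact hne (by simp [← hij])
  · simp

open Polynomial in
theorem Polynomial.X_sub_C_pow_dvd_of_hasseDeriv_eval {R : Type*} [CommRing R] {P : R[X]} {x : R}
    {M : ℕ} (h : ∀ l < M, (hasseDeriv l P).eval x = 0) : (X - C x) ^ M ∣ P := by
  rw [X_sub_C_pow_dvd_iff, X_pow_dvd_iff]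
  intro l hl
  rw [← taylor_apply, taylor_coeff, h l hl]

open Polynomial in
theorem Polynomial.mul_card_le_natDegree {F : Type*} [Field F] {P : F[X]} (hP : P ≠ 0)
    {M : ℕ} (s : Finset F) (h : ∀ x ∈ s, (X - C x) ^ M ∣ P) : M * s.card ≤ P.natDegree := by
  have h1 : ∏ x ∈ s, (X - C x) ^ M ∣ P := by
    refine Finset.prod_dvd_of_coprime (fun x _ y _ hxy => ?_) h
    exact (isCoprime_X_sub_C_of_isUnit_sub (sub_ne_zero.2 hxy).isUnit).pow
  have h2 := natDegree_le_of_dvd h1 hP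
  rw [natDegree_prod _ _ fun x _ => pow_ne_zero _ (X_sub_C_ne_zero x)] at h2
  simpa [mul_comm] using h2

open Polynomial in
/-- Stepanov's method, with explicit parameters. -/
theorem stepanov_mul_card_le {F : Type*} [Field F] [Fintype F] [DecidableEq F] {f : F[X]}
    (hf : f ≠ 0) {d m : ℕ} (hd : 0 < d) (hdm : d * m + 1 = Fintype.card F)
    {ζ : F} (hζ : IsPrimitiveRoot ζ d)
    (hmult : ∀ s, s ∣ d → 1 < s → ∃ c, ¬ s ∣ f.rootMultiplicity c) {M K B : ℕ}
    (hM : M ≤ Fintype.card F)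
    (hb : d * (B - 1) + (d - 1) * f.natDegree < Fintype.card F)
    (hcount : M * (B + K + M * f.natDegree) < d * K * B) (w : F) :
    M * (Finset.univ.filter fun x => f.eval x ≠ 0 ∧ f.eval x ^ m = w).card ≤
      (M + Fintype.card F) * f.natDegree + B + Fintype.card F * K := by
  obtain ⟨p, hp⟩ := CharP.exists F
  obtain ⟨n, hpp, hQ⟩ := FiniteField.card F p
  have : Fact p.Prime := ⟨hpp⟩
  set r := f.natDegree with hr
  set T := B + K + M * r with hT
  have hE := fun N l b hl => exists_hasseDeriv_pow_mul_X_pow hf N l b hl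
  choose! E hE1 hE2 using hE
  -- the auxiliary polynomial, from a linear system with more unknowns than equations
  let G : Fin d × Fin K × Fin B → ℕ → F[X] := fun i l =>
    C (w ^ (i.1 : ℕ)) * E (M + i.1 * m) l i.2.2 * X ^ (i.2.1 : ℕ)
  obtain ⟨a, ha0, ha⟩ : ∃ a : Fin d × Fin K × Fin B → F, a ≠ 0 ∧
      ∀ l < M, ∑ i, C (a i) * G i l = 0 := by
    let A : Matrix (Fin M × Fin T) (Fin d × Fin K × Fin B) F :=
      fun lt i => (G i lt.1).coeff lt.2
    have hker : LinearMap.ker A.mulVecLin ≠ ⊥ := by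
      apply LinearMap.ker_ne_bot_of_finrank_lt
      simp only [Module.finrank_fintype_fun_eq_card, Fintype.card_prod, Fintype.card_fin]
      rw [← mul_assoc]
      exact hcount
    obtain ⟨a, ha, ha0⟩ := Submodule.exists_mem_ne_zero_of_ne_bot hker
    refine ⟨a, ha0, fun l hl => ?_⟩
    ext t
    rw [finsetSum_coeff, coeff_zero]
    by_cases ht : t < T
    · have := congrFun (LinearMap.mem_ker.1 ha) (⟨l, hl⟩, ⟨t, ht⟩)
      simp only [Pi.zero_apply] at this
      rw [← this]
      exact Finset.sum_congr rfl fun i _ => by rw [coeff_C_mul, mul_comm]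
    · refine Finset.sum_eq_zero fun i _ => ?_
      rw [coeff_C_mul, coeff_eq_zero_of_natDegree_lt, mul_zero]
      have h1 : (G i l).natDegree ≤ (i.2.2 + l * r) + i.2.1 := by
        refine natDegree_mul_le.trans (add_le_add ?_ (natDegree_X_pow_le _))
        refine (natDegree_C_mul_le _ _).trans (hE2 _ _ _ ?_)
        exact hl.le.trans (Nat.le_add_right _ _)
      have h2 : l * r ≤ M * r := Nat.mul_le_mul_right _ hl.le
      have := i.2.2.2
      have := i.2.1.2
      omega
  set Q := Fintype.card F with hQdef
  set P : F[X] := ∑ i : Fin d × Fin K × Fin B,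
    C (a i) * (f ^ (M + i.1 * m) * X ^ (i.2.2 : ℕ) * X ^ (Q * i.2.1)) with hP
  have hP0 : P ≠ 0 := by
    intro h0
    apply ha0
    let a' : ℕ → Fin K × Fin B → F := fun j kb => if h : j < d then a (⟨j, h⟩, kb) else 0
    let e : ℕ → F[X][X] := fun j => ∑ kb : Fin K × Fin B,
      C (C (a' j kb) * X ^ (kb.1 : ℕ)) * X ^ (kb.2 : ℕ)
    have h1 : ∀ j < d, e j = 0 := by
      refine eq_zero_of_sum_eval₂_expand_mul_pow_eq_zero hf hd hdm hζ hmult hb e ?_ ?_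
      · intro j
        refine natDegree_sum_le_of_forall_le _ _ fun kb _ => ?_
        refine (natDegree_C_mul_X_pow_le _ _).trans ?_
        have := kb.2.2
        omega
      · have h2 : P = f ^ M * ∑ j ∈ Finset.range d,
            (e j).eval₂ (expand F Q : F[X] →+* F[X]) X * (f ^ m) ^ j := by
          rw [hP, Fintype.sum_prod_type, ← Fin.sum_univ_eq_sum_range (fun j =>
            (e j).eval₂ (expand F Q : F[X] →+* F[X]) X * (f ^ m) ^ j), Finset.mul_sum]
          refine Finset.sum_congr rfl fun j _ => ?_
          simp only [e]
          rw [eval₂_finsetSum, Finset.sum_mul, Finset.mul_sum]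
          refine Finset.sum_congr rfl fun kb _ => ?_
          simp only [a', j.2, dif_pos, eval₂_mul, eval₂_C, eval₂_X_pow, RingHom.coe_coe]
          rw [map_mul, expand_C, map_pow, expand_X]
          rw [pow_add, mul_comm (j : ℕ) m, pow_mul, pow_mul]
          ring
        rw [h2] at h0
        exact (mul_eq_zero.1 h0).resolve_left (pow_ne_zero _ hf)
    ext ⟨j, k, b⟩
    have h3 := congrArg (fun q => coeff (coeff q b) k) (h1 j j.2)
    simp only [e, finsetSum_coeff, coeff_C_mul, coeff_X_pow, coeff_zero, a', j.2, dif_pos] at h3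
    rw [Finset.sum_eq_single (k, b)] at h3
    · simpa using h3
    · rintro ⟨k', b'⟩ - hne
      rw [Ne, Prod.mk.injEq, not_and_or] at hne
      by_cases hbb : (b : ℕ) = b'
      · have : (k : ℕ) ≠ k' := fun h => by
          rcases hne with h' | h'
          · exact h' (Fin.ext h.symm)
          · exact h' (Fin.ext hbb.symm)
        simp [hbb, coeff_X_pow, this]
      · simp [hbb]
    · simp
  have hdeg : P.natDegree ≤ (M + Q) * r + B + Q * K := by
    refine natDegree_sum_le_of_forall_le _ _ fun i _ => ?_
    refine (natDegree_C_mul_le _ _).trans (natDegree_mul_le.trans ?_)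
    refine add_le_add (natDegree_mul_le.trans (add_le_add ?_ ?_)) ?_
    · refine natDegree_pow_le.trans (Nat.mul_le_mul_right _ (Nat.add_le_add_left ?_ _))
      have : i.1 * m ≤ d * m := Nat.mul_le_mul_right _ i.1.2.le
      omega
    · exact (natDegree_X_pow_le _).trans i.2.2.2.le
    · exact (natDegree_X_pow_le _).trans (Nat.mul_le_mul_left _ i.2.1.2.le)
  refine (mul_card_le_natDegree hP0 _ fun x hx => ?_).trans hdeg
  obtain ⟨hx0, hxw⟩ := (Finset.mem_filter.1 hx).2
  refine X_sub_C_pow_dvd_of_hasseDeriv_eval fun l hl => ?_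
  have h1 : (hasseDeriv l P).eval x = f.eval x ^ (M - l) * (∑ i, C (a i) * G i l).eval x := by
    rw [hP, map_sum, eval_finsetSum, eval_finsetSum, Finset.mul_sum]
    refine Finset.sum_congr rfl fun i _ => ?_
    have h2 : l ≤ M + i.1 * m := hl.le.trans (Nat.le_add_right _ _)
    have h3 : M + i.1 * m - l = M - l + m * i.1 := by rw [mul_comm m]; omega
    rw [← smul_eq_C_mul, map_smul, hQ, hasseDeriv_mul_X_pow_mul _ _ _ (by rw [← hQ]; omega), ← hQ,
      ← hE1 _ _ _ h2, smul_eq_C_mul, h3]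
    simp only [eval_mul, eval_C, eval_pow, eval_X, G, pow_add, pow_mul, hxw]
    rw [show x ^ Q = x from FiniteField.pow_card x]
    ring
  rw [h1, ha l hl, eval_zero, mul_zero]

open Polynomial in
/-- Stepanov's bound: the values of `f ^ ((Q - 1) / d)` over a field with `Q = R ^ 2` elements are
equidistributed up to `O(R)`. -/
theorem exists_stepanov_bound (d r : ℕ) (hd : 0 < d) : ∃ R₀ A : ℕ, ∀ (F : Type*) [Field F] [Fintype F]
    [DecidableEq F] (R m : ℕ) (ζ : F) (f : F[X]), R₀ ≤ R → Fintype.card F = R ^ 2 →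
    d * m + 1 = R ^ 2 → IsPrimitiveRoot ζ d → f ≠ 0 → f.natDegree = r →
    (∀ s, s ∣ d → 1 < s → ∃ c, ¬ s ∣ f.rootMultiplicity c) → ∀ w,
    d * (Finset.univ.filter fun x => f.eval x ≠ 0 ∧ f.eval x ^ m = w).card ≤ R ^ 2 + A * R := by
  set s := d + d ^ 2 * r + 1 with hs
  set c := d * (r + 1) with hc
  refine ⟨d * s + s * c + d + 1, s + r + 1 + d * r, ?_⟩
  intro F _ _ _ R m ζ f hR hcard hdm hζ hf hr hmult w
  set N := (Finset.univ.filter fun x => f.eval x ≠ 0 ∧ f.eval x ^ m = w).card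
  set B := R ^ 2 / d - r with hB
  have hR1 : 1 ≤ R := by omega
  have hRR : (d * s + s * c + d + 1) * R ≤ R ^ 2 := by rw [sq]; exact Nat.mul_le_mul_right _ hR
  have hcR : c < R ^ 2 := by
    have : c ≤ s * c := Nat.le_mul_of_pos_left _ (by omega)
    nlinarith
  have hdiv : c ≤ R ^ 2 → R ^ 2 < d * B + c := by
    intro h
    have h1 : r + 1 ≤ R ^ 2 / d := by
      rw [Nat.le_div_iff_mul_le hd, mul_comm]; exact h
    have h2 := Nat.lt_mul_div_succ (R ^ 2) hd
    have h3 : R ^ 2 / d = B + r := by omega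
    rw [h3] at h2
    calc R ^ 2 < d * (B + r + 1) := h2
      _ = d * B + c := by rw [hc]; ring
  have hB1 := hdiv hcR.le
  have hBpos : 0 < B := by
    rcases Nat.eq_zero_or_pos B with h | h
    · rw [h] at hB1; omega
    · exact h
  have hBle : d * B + d * r ≤ R ^ 2 := by
    have h1 : B + r = R ^ 2 / d := by omega
    rw [← mul_add, h1]
    exact Nat.mul_div_le _ _
  have hBQ : B ≤ R ^ 2 := (Nat.sub_le _ _).trans (Nat.div_le_self _ _)
  have key := stepanov_mul_card_le hf hd (m := m) (by rw [hdm, hcard]) hζ hmult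
    (M := d * R) (K := R + s) (B := B) (by
      rw [hcard, sq]; exact Nat.mul_le_mul_right _ (by omega)) (by
      rw [hcard, hr]
      have h1 : d * (B - 1) + d = d * B := by
        rw [← Nat.mul_succ]; congr 1; omega
      have h2 : (d - 1) * r ≤ d * r := Nat.mul_le_mul_right _ (Nat.sub_le _ _)
      omega) (by
      rw [hr, mul_assoc d R, mul_assoc d (R + s)]
      refine Nat.mul_lt_mul_of_pos_left ?_ hd
      have h4 : d * (R * (R + s) + d * r * R ^ 2) < d * (s * B) := by
        have h5 : s * R ^ 2 + s ≤ s * (d * B) + s * c := by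
          rw [← mul_add, ← Nat.mul_succ]; exact Nat.mul_le_mul_left _ hB1
        have h6 : s * R ^ 2 = d * R ^ 2 + d ^ 2 * r * R ^ 2 + R ^ 2 := by rw [hs]; ring
        have h7 : s * c ≤ s * c * R := Nat.le_mul_of_pos_right _ hR1
        nlinarith
      have h8 := Nat.lt_of_mul_lt_mul_left h4
      nlinarith) w
  rw [hcard, hr] at key
  have h9 : R * (d * N) ≤ R * (R ^ 2 + (s + r + 1 + d * r) * R) := by
    have h10 : d * r ≤ d * r * R := Nat.le_mul_of_pos_right _ hR1
    have h11 : R * (d * r) ≤ R * (d * r * R) := Nat.mul_le_mul_left _ h10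
    nlinarith
  exact Nat.le_of_mul_le_mul_left h9 hR1

/-- A family of multiplicative characters of a finite field consists of powers of a single one,
with exponents jointly coprime to its order. -/
theorem MulChar.exists_common_generator {K : Type*} [Field K] [Fintype K] {ι : Type*} 
    {χ : ι → MulChar K ℂ} (hχ : ∃ i, χ i ≠ 1) :
    ∃ (ψ : MulChar K ℂ) (a : ι → ℕ), 1 < orderOf ψ ∧ (∀ i, 0 < a i) ∧ (∀ i, χ i = ψ ^ a i) ∧
      ∀ s, s ∣ orderOf ψ → 1 < s → ∃ i, ¬ s ∣ a i := by
  have hcyc : IsCyclic (MulChar K ℂ) := by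
    have e := (MulChar.mulEquiv_units K ℂ).some
    exact e.isCyclic.2 inferInstance
  have hfin : Finite (MulChar K ℂ) := Finite.of_equiv _ (MulChar.mulEquiv_units K ℂ).some.symm.toEquiv
  set H := Subgroup.closure (Set.range χ) with hH
  obtain ⟨⟨ψ, hψ⟩, hgen⟩ := IsCyclic.exists_generator (α := H)
  have hHψ : H = Subgroup.zpowers ψ := by
    apply le_antisymm
    · intro x hx
      obtain ⟨k, hk⟩ := Subgroup.mem_zpowers_iff.1 (hgen ⟨x, hx⟩)
      exact Subgroup.mem_zpowers_iff.2 ⟨k, congrArg Subtype.val hk⟩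
    · rwa [Subgroup.zpowers_le]
  have hd : 0 < orderOf ψ := orderOf_pos ψ
  have ha : ∀ i, ∃ a : ℕ, 0 < a ∧ χ i = ψ ^ a := by
    intro i
    have h1 : χ i ∈ Subgroup.zpowers ψ := hHψ ▸ Subgroup.subset_closure ⟨i, rfl⟩
    obtain ⟨b, hb⟩ := mem_powers_iff_mem_zpowers.2 h1
    exact ⟨b + orderOf ψ, by omega, by rw [pow_add, pow_orderOf_eq_one, mul_one]; exact hb.symm⟩
  choose a ha0 ha using ha
  refine ⟨ψ, a, ?_, ha0, ha, ?_⟩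
  · by_contra h
    have h1 : orderOf ψ = 1 := by omega
    obtain ⟨i, hi⟩ := hχ
    exact hi (by rw [ha, orderOf_eq_one_iff.1 h1, one_pow])
  · intro s hs hs1
    by_contra! hall
    have h1 : H ≤ Subgroup.zpowers (ψ ^ s) := by
      rw [hH, Subgroup.closure_le]
      rintro _ ⟨i, rfl⟩
      obtain ⟨k, hk⟩ := hall i
      exact Subgroup.mem_zpowers_iff.2 ⟨k, by rw [zpow_natCast, ← pow_mul, ← hk, ha]⟩
    obtain ⟨k, hk⟩ := mem_powers_iff_mem_zpowers.2 (h1 hψ)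
    simp only at hk
    have h2 : ψ ^ (s * k) = ψ ^ 1 := by rw [pow_mul, hk, pow_one]
    have h3 := (pow_eq_pow_iff_modEq.1 h2).of_dvd hs
    have h4 : s ∣ 1 := (h3.dvd_iff dvd_rfl).1 (Dvd.intro _ rfl)
    exact absurd (Nat.le_of_dvd one_pos h4) (by omega)

theorem MulChar.pow_div_orderOf_eq_one_of_apply_eq_one {K : Type*} [Field K] [Fintype K]
    (ψ : MulChar K ℂ) {v : K} (hv : ψ v = 1) : v ^ ((Fintype.card K - 1) / orderOf ψ) = 1 := by
  classical
  obtain ⟨γ, hγ⟩ := IsCyclic.exists_generator (α := Kˣ)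
  have hv0 : v ≠ 0 := by rintro rfl; simp at hv
  obtain ⟨i, hi⟩ := mem_powers_iff_mem_zpowers.2 (hγ (Units.mk0 v hv0))
  have hvi : (γ : K) ^ i = v := by
    simpa using congrArg Units.val hi
  have h1 : (ψ ^ i) = 1 := by
    refine MulChar.eq_iff hγ _ _ |>.2 ?_
    rw [MulChar.pow_apply_coe, MulChar.one_apply_coe, ← map_pow, hvi, hv]
  obtain ⟨k, hk⟩ := orderOf_dvd_of_pow_eq_one h1
  rw [← hvi, ← pow_mul, hk, mul_comm, ← mul_assoc,
    Nat.div_mul_cancel (MulChar.orderOf_dvd_card_sub_one K ψ), pow_mul]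
  have := FiniteField.pow_card_sub_one_eq_one (γ : K) γ.ne_zero
  rw [this, one_pow]

theorem sum_nthRootsFinset_eq_zero {d : ℕ} (hd : 1 < d) :
    ∑ ξ ∈ Polynomial.nthRootsFinset d (1 : ℂ), ξ = 0 := by
  have hω := Complex.isPrimitiveRoot_exp d (by omega)
  set ω := Complex.exp (2 * Real.pi * Complex.I / d)
  have h0 : 0 < d := by omega
  have hω0 : ω ≠ 0 := hω.ne_zero (by omega)
  have h1 : ω * ∑ ξ ∈ Polynomial.nthRootsFinset d (1 : ℂ), ξ =
      ∑ ξ ∈ Polynomial.nthRootsFinset d (1 : ℂ), ξ := by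
    rw [Finset.mul_sum]
    refine Finset.sum_nbij' (fun ξ => ω * ξ) (fun ξ => ω⁻¹ * ξ) ?_ ?_ ?_ ?_ ?_
    · intro ξ hξ
      rw [Polynomial.mem_nthRootsFinset h0] at hξ ⊢
      rw [mul_pow, hξ, hω.pow_eq_one, one_mul]
    · intro ξ hξ
      rw [Polynomial.mem_nthRootsFinset h0] at hξ ⊢
      rw [mul_pow, hξ, inv_pow, hω.pow_eq_one, inv_one, one_mul]
    · intro ξ _; rw [inv_mul_cancel_left₀ hω0]
    · intro ξ _; rw [mul_inv_cancel_left₀ hω0]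
    · intro ξ _; rfl
  have h2 : (ω - 1) * ∑ ξ ∈ Polynomial.nthRootsFinset d (1 : ℂ), ξ = 0 := by
    rw [sub_mul, h1, one_mul, sub_self]
  exact (mul_eq_zero.1 h2).resolve_left (sub_ne_zero.2 (hω.ne_one hd))

/-- A sum of `d`-th roots of unity, each of which occurs at most `A / d` times, is small. -/
theorem norm_sum_le_of_card_fiber_le {α : Type*} (s : Finset α) (g : α → ℂ) {d : ℕ} (hd : 1 < d)
    (hg : ∀ x ∈ s, g x ^ d = 1) {A : ℝ}
    (hA : ∀ ξ : ℂ, d * ((s.filter fun x => g x = ξ).card : ℝ) ≤ A) :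
    ‖∑ x ∈ s, g x‖ ≤ A - s.card := by
  have h0 : 0 < d := by omega
  set N := Polynomial.nthRootsFinset d (1 : ℂ) with hN
  have hmap : ∀ x ∈ s, g x ∈ N := fun x hx =>
    (Polynomial.mem_nthRootsFinset h0 _).2 (hg x hx)
  have hNc : N.card = d := (Complex.isPrimitiveRoot_exp d h0.ne').card_nthRootsFinset
  have hd0 : (d : ℝ) ≠ 0 := by positivity
  have h1 : ∑ x ∈ s, g x = ∑ ξ ∈ N, ξ * (((s.filter fun x => g x = ξ).card : ℂ) - (A / d : ℝ)) := by
    simp_rw [mul_sub]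
    rw [Finset.sum_sub_distrib, ← Finset.sum_mul, sum_nthRootsFinset_eq_zero hd, zero_mul, sub_zero,
      ← Finset.sum_fiberwise_of_maps_to hmap]
    refine Finset.sum_congr rfl fun ξ _ => ?_
    rw [Finset.sum_congr rfl fun x hx => (Finset.mem_filter.1 hx).2, Finset.sum_const, nsmul_eq_mul,
      mul_comm]
  have h2 : (s.card : ℝ) = ∑ ξ ∈ N, ((s.filter fun x => g x = ξ).card : ℝ) := by
    rw [Finset.card_eq_sum_card_fiberwise hmap]
    push_cast
    rfl
  rw [h1, h2]
  calc _ ≤ ∑ ξ ∈ N, (A / d - ((s.filter fun x => g x = ξ).card : ℝ)) := by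
        refine norm_sum_le_of_le _ fun ξ hξ => ?_
        have hξ1 : ‖ξ‖ = 1 := Complex.norm_eq_one_of_pow_eq_one
          ((Polynomial.mem_nthRootsFinset h0 _).1 hξ) h0.ne'
        rw [norm_mul, hξ1, one_mul, norm_sub_rev]
        have h3 : ((s.filter fun x => g x = ξ).card : ℝ) ≤ A / d := by
          rw [le_div_iff₀ (by positivity), mul_comm]; exact hA ξ
        rw [show ((s.filter fun x => g x = ξ).card : ℂ) = (((s.filter fun x => g x = ξ).card : ℝ) : ℂ)
          by push_cast; rfl, ← Complex.ofReal_sub, Complex.norm_real, Real.norm_of_nonneg (by linarith)]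
    _ = _ := by
        rw [Finset.sum_sub_distrib, Finset.sum_const, hNc, nsmul_eq_mul, mul_div_cancel₀ _ hd0]

open Polynomial in
/-- A non-optimal square-root bound, uniform over all extensions of even degree, for the
character sums attached to a nontrivial family of multiplicative characters. -/
theorem MulChar.exists_norm_sum_prod_norm_le {K : Type*} [Field K] [Fintype K] {ι : Type*}
    [Fintype ι] {c : ι → K} (hc : Function.Injective c) {χ : ι → MulChar K ℂ}
    (hχ : ∃ i, χ i ≠ 1) :
    ∃ A : ℝ, ∀ (n : ℕ) (L : Type) [Field L] [Fintype L] [Algebra K L],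
      Module.finrank K L = 2 * n →
      ‖∑ x : L, ∏ i, χ i (Algebra.norm K (algebraMap K L (c i) + x))‖
        ≤ A * (Fintype.card K : ℝ) ^ n := by
  classical
  obtain ⟨ψ, a, hd1, ha0, ha, hmult⟩ := MulChar.exists_common_generator hχ
  set d := orderOf ψ with hd
  obtain ⟨R₀, A, hA⟩ := exists_stepanov_bound d (∑ i, a i) (by omega)
  refine ⟨A + Fintype.card ι + R₀, fun n L _ _ _ hn => ?_⟩
  set q := Fintype.card K with hq
  set R := q ^ n with hR
  have hcard : Fintype.card L = R ^ 2 := by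
    rw [Module.card_eq_pow_finrank (K := K) (V := L), hn, hR, ← pow_mul, mul_comm]
  set f : L[X] := ∏ i, (X - C (-(algebraMap K L (c i)))) ^ a i with hf
  have hf0 : f ≠ 0 := Finset.prod_ne_zero_iff.2 fun i _ => pow_ne_zero _ (X_sub_C_ne_zero _)
  have hfe : ∀ x, f.eval x = ∏ i, (algebraMap K L (c i) + x) ^ a i := by
    intro x
    rw [hf, eval_prod]
    refine Finset.prod_congr rfl fun i _ => ?_
    rw [eval_pow, eval_sub, eval_X, eval_C, sub_neg_eq_add, add_comm]
  have hdeg : f.natDegree = ∑ i, a i := by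
    rw [hf, natDegree_prod _ _ fun i _ => pow_ne_zero _ (X_sub_C_ne_zero _)]
    exact Finset.sum_congr rfl fun i _ => by rw [natDegree_pow, natDegree_X_sub_C, mul_one]
  have hroot : ∀ i, f.rootMultiplicity (-(algebraMap K L (c i))) = a i := by
    intro i
    have h1 : f.roots = ∑ j, a j • {-(algebraMap K L (c j))} := by
      rw [hf, roots_prod _ _ hf0, Multiset.bind, Finset.sum_eq_multiset_sum]
      simp [Multiset.join]
    rw [← count_roots, h1, Multiset.count_sum', Finset.sum_eq_single i]
    · simp
    · intro j _ hj
      rw [Multiset.count_nsmul, Multiset.count_singleton, if_neg, mul_zero]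
      intro h
      exact hj (hc ((algebraMap K L).injective (neg_injective h))).symm
    · simp
  have hg : ∀ x, ∏ i, χ i (Algebra.norm K (algebraMap K L (c i) + x)) =
      ψ (Algebra.norm K (f.eval x)) := by
    intro x
    rw [hfe, map_prod, map_prod]
    refine Finset.prod_congr rfl fun i _ => ?_
    rw [ha, MulChar.pow_apply' _ (ha0 i).ne', map_pow, map_pow]
  simp_rw [hg]
  set g : L → ℂ := fun x => ψ (Algebra.norm K (f.eval x)) with hgdef
  set s := Finset.univ.filter fun x : L => f.eval x ≠ 0 with hs
  have hgd : ∀ x ∈ s, g x ^ d = 1 := by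
    intro x hx
    have h0 : Algebra.norm K (f.eval x) ≠ 0 := Algebra.norm_ne_zero_iff.2 (Finset.mem_filter.1 hx).2
    rw [hgdef]
    simp only
    rw [← MulChar.pow_apply' _ (by omega), pow_orderOf_eq_one, MulChar.one_apply (isUnit_iff_ne_zero.2 h0)]
  have hsum : ∑ x : L, ψ (Algebra.norm K (f.eval x)) = ∑ x ∈ s, g x := by
    rw [hs, Finset.sum_filter]
    refine Finset.sum_congr rfl fun x _ => ?_
    split_ifs with h
    · rfl
    · rw [not_not.1 h, Algebra.norm_zero, MulChar.map_zero]
  rw [hsum]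
  have hscard : s.card + Fintype.card ι ≥ R ^ 2 := by
    have h1 : (Finset.univ.filter fun x : L => ¬ f.eval x ≠ 0) ⊆
        Finset.univ.image fun i => -(algebraMap K L (c i)) := by
      intro x hx
      have h2 := not_not.1 (Finset.mem_filter.1 hx).2
      rw [hfe, Finset.prod_eq_zero_iff] at h2
      obtain ⟨i, -, hi⟩ := h2
      exact Finset.mem_image.2 ⟨i, Finset.mem_univ _, neg_eq_of_add_eq_zero_right (eq_zero_of_pow_eq_zero hi)⟩
    have h3 := (Finset.card_le_card h1).trans Finset.card_image_le
    have h4 := Finset.card_filter_add_card_filter_not (s := (Finset.univ : Finset L)) (fun x : L => f.eval x ≠ 0)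
    rw [Finset.card_univ, hcard] at h4
    rw [Finset.card_univ] at h3
    rw [hs]; omega
  have hq2 : 1 < q := Fintype.one_lt_card
  have hR1 : 1 ≤ R := Nat.one_le_pow _ _ (by omega)
  have hR1' : (1 : ℝ) ≤ R := by exact_mod_cast hR1
  have hcast : ((q : ℝ)) ^ n = (R : ℝ) := by rw [hR]; push_cast; rfl
  rw [hcast]
  by_cases hlt : R < R₀
  · have h1 : ‖∑ x ∈ s, g x‖ ≤ ∑ x ∈ s, (1 : ℝ) := norm_sum_le_of_le _ fun x hx =>
      (Complex.norm_eq_one_of_pow_eq_one (hgd x hx) (by omega)).le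
    rw [Finset.sum_const, nsmul_eq_mul, mul_one] at h1
    have h2 : (s.card : ℝ) ≤ R ^ 2 := by
      have := Finset.card_le_univ s
      rw [hcard] at this
      exact_mod_cast this
    have h3 : (R : ℝ) ≤ R₀ := by exact_mod_cast hlt.le
    have h4 : (0 : ℝ) ≤ A * R := by positivity
    have h5 : (0 : ℝ) ≤ Fintype.card ι * R := by positivity
    nlinarith
  · have hdq : d ∣ q - 1 := MulChar.orderOf_dvd_card_sub_one K ψ
    set e := (Fintype.card L - 1) / (q - 1) with he
    have hqQ : q - 1 ∣ Fintype.card L - 1 := by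
      have h1 := Nat.sub_dvd_pow_sub_pow q 1 (2 * n)
      rw [one_pow, ← hn, ← Module.card_eq_pow_finrank] at h1
      exact h1
    have hdm : d * (e * ((q - 1) / d)) + 1 = R ^ 2 := by
      rw [mul_left_comm, Nat.mul_div_cancel' hdq, he, Nat.div_mul_cancel hqQ, hcard]
      exact Nat.sub_add_cancel (Nat.one_le_pow _ _ hR1)
    obtain ⟨γ, hγ⟩ := IsCyclic.exists_ofOrder_eq_natCard (α := Lˣ)
    have hγ' : IsPrimitiveRoot (γ : L) (Fintype.card L - 1) := by
      rw [IsPrimitiveRoot.coe_units_iff, ← Fintype.card_units, ← Nat.card_eq_fintype_card, ← hγ]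
      exact IsPrimitiveRoot.orderOf γ
    have hζ : IsPrimitiveRoot ((γ : L) ^ (e * ((q - 1) / d))) d := by
      refine hγ'.pow ?_ ?_
      · have := Fintype.one_lt_card (α := L); omega
      · rw [hcard, mul_comm, ← hdm, Nat.add_sub_cancel]
    have key := hA L R (e * ((q - 1) / d)) _ f (not_lt.1 hlt) hcard hdm hζ hf0 hdeg
      (fun t ht ht1 => by
        obtain ⟨i, hi⟩ := hmult t ht ht1
        exact ⟨_, by rw [hroot i]; exact hi⟩)
    have h1 := norm_sum_le_of_card_fiber_le s g hd1 hgd (A := (R : ℝ) ^ 2 + A * R) (fun ξ => by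
      rcases (s.filter fun x => g x = ξ).eq_empty_or_nonempty with h | ⟨x₁, hx₁⟩
      · rw [h, Finset.card_empty, Nat.cast_zero, mul_zero]; positivity
      · rw [Finset.mem_filter] at hx₁
        have hx10 := (Finset.mem_filter.1 hx₁.1).2
        have h2 := key (f.eval x₁ ^ (e * ((q - 1) / d)))
        have h3 : (s.filter fun x => g x = ξ) ⊆ (Finset.univ.filter fun x => f.eval x ≠ 0 ∧
            f.eval x ^ (e * ((q - 1) / d)) = f.eval x₁ ^ (e * ((q - 1) / d))) := by
          intro x hx
          rw [Finset.mem_filter] at hx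
          have hx0 := (Finset.mem_filter.1 hx.1).2
          refine Finset.mem_filter.2 ⟨Finset.mem_univ _, hx0, ?_⟩
          have h4 : ψ (Algebra.norm K (f.eval x / f.eval x₁)) = 1 := by
            have h5 : ψ (Algebra.norm K (f.eval x / f.eval x₁)) * g x₁ = g x₁ := by
              simp only [hgdef]
              rw [← map_mul, ← map_mul, div_mul_cancel₀ _ hx10]
              exact hx.2.trans hx₁.2.symm
            have h6 : g x₁ ≠ 0 := by
              intro h
              have := hgd x₁ hx₁.1
              rw [h, zero_pow (by omega)] at this
              exact zero_ne_one this
            exact mul_right_cancel₀ h6 (by rw [h5, one_mul])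
          have h7 := ψ.pow_div_orderOf_eq_one_of_apply_eq_one h4
          have h8 := congrArg (algebraMap K L) h7
          rw [map_pow, FiniteField.algebraMap_norm_eq_pow, map_one, ← pow_mul,
            Nat.card_eq_fintype_card, Nat.card_eq_fintype_card, div_pow,
            div_eq_one_iff_eq (pow_ne_zero _ hx10)] at h8
          exact h8
        have h9 := (Nat.mul_le_mul_left d (Finset.card_le_card h3)).trans h2
        exact_mod_cast h9)
    have h10 : (R : ℝ) ^ 2 ≤ s.card + Fintype.card ι := by exact_mod_cast hscard
    have h4 : (0 : ℝ) ≤ R₀ * R := by positivity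
    have h5 : (Fintype.card ι : ℝ) ≤ Fintype.card ι * R := le_mul_of_one_le_right (by positivity) hR1'
    nlinarith

namespace Polynomial

theorem finite_setOf_monic_natDegree_eq (K : Type*) [Field K] [Finite K] (n : ℕ) :
    {g : K[X] | g.Monic ∧ g.natDegree = n}.Finite := by
  have h : Finite {g : K[X] // g.Monic ∧ g.natDegree = n} :=
    Finite.of_equiv _ ((monicEquivDegreeLT n).trans (degreeLTEquiv K n).toEquiv).symm
  exact @Set.toFinite _ _ h

/-- The finite set of monic polynomials of degree `n` over a finite field. -/
noncomputable def monicFinset (K : Type*) [Field K] [Finite K] (n : ℕ) : Finset K[X] :=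
  (finite_setOf_monic_natDegree_eq K n).toFinset

theorem mem_monicFinset {K : Type*} [Field K] [Finite K] {n : ℕ} {g : K[X]} :
    g ∈ monicFinset K n ↔ g.Monic ∧ g.natDegree = n := by
  simp [monicFinset]

open Classical in
/-- The finite set of monic irreducible polynomials of degree `n` over a finite field. -/
noncomputable def monicIrredFinset (K : Type*) [Field K] [Finite K] (n : ℕ) : Finset K[X] :=
  (monicFinset K n).filter Irreducible

theorem mem_monicIrredFinset {K : Type*} [Field K] [Finite K] {n : ℕ} {g : K[X]} :
    g ∈ monicIrredFinset K n ↔ g.Monic ∧ g.natDegree = n ∧ Irreducible g := by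
  classical
  simp [monicIrredFinset, mem_monicFinset, and_assoc]

theorem monicFinset_zero (K : Type*) [Field K] [Finite K] : monicFinset K 0 = {1} := by
  ext g
  rw [mem_monicFinset, Finset.mem_singleton]
  constructor
  · rintro ⟨h1, h2⟩; exact eq_one_of_monic_natDegree_zero h1 h2
  · rintro rfl; exact ⟨monic_one, natDegree_one⟩

open Classical UniqueFactorizationMonoid in
theorem sum_natDegree_irred_pow_dvd {K : Type*} [Field K] [Finite K] {n : ℕ} {g : K[X]}
    (hg : g ∈ monicFinset K n) :
    ∑ k ∈ Finset.Icc 1 n, ∑ P ∈ monicIrredFinset K k, ∑ e ∈ Finset.Icc 1 n,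
      (if P ^ e ∣ g then k else 0) = n := by
  obtain ⟨hmon, hdeg⟩ := mem_monicFinset.1 hg
  have hg0 := hmon.ne_zero
  set N := normalizedFactors g with hN
  have hNm : ∀ P ∈ N, P.Monic ∧ Irreducible P ∧ P ∣ g := fun P hP => by
    have h1 := irreducible_of_normalized_factor P hP
    have h2 := normalize_normalized_factor P hP
    exact ⟨h2 ▸ monic_normalize h1.ne_zero, h1, dvd_of_mem_normalizedFactors hP⟩
  have hsum : n = ∑ P ∈ N.toFinset, N.count P * P.natDegree := by
    have h1 : N.prod = g := by rw [prod_normalizedFactors_eq hg0, hmon.normalize_eq_self]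
    rw [← hdeg, ← h1, natDegree_multiset_prod_of_monic _ fun P hP => (hNm P hP).1,
      Finset.sum_multiset_map_count]
    rfl
  have hcount : ∀ P : K[X], P.Monic → Irreducible P → ∀ e, P ^ e ∣ g ↔ e ≤ N.count P := by
    intro P hP1 hP2 e
    rw [pow_dvd_iff_le_emultiplicity, le_emultiplicity_iff_replicate_le_normalizedFactors hP2 hg0,
      hP1.normalize_eq_self, Multiset.le_count_iff_replicate_le]
  have hle : ∀ P ∈ N, P.natDegree * N.count P ≤ n := by
    intro P hP
    obtain ⟨h1, h2, -⟩ := hNm P hP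
    have h3 := natDegree_le_of_dvd ((hcount P h1 h2 _).2 le_rfl) hg0
    rwa [natDegree_pow, mul_comm, hdeg] at h3
  have hinner : ∀ k, ∀ P ∈ monicIrredFinset K k,
      ∑ e ∈ Finset.Icc 1 n, (if P ^ e ∣ g then k else 0) = N.count P * P.natDegree := by
    intro k P hP
    obtain ⟨h1, h2, h3⟩ := mem_monicIrredFinset.1 hP
    rw [← Finset.sum_filter, Finset.sum_const, smul_eq_mul, h2]
    congr 1
    have hc : N.count P ≤ n := by
      by_cases hPN : P ∈ N
      · exact (Nat.le_mul_of_pos_left _ h3.natDegree_pos).trans (hle P hPN)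
      · rw [Multiset.count_eq_zero_of_notMem hPN]; exact Nat.zero_le _
    have : (Finset.Icc 1 n).filter (fun e => P ^ e ∣ g) = Finset.Icc 1 (N.count P) := by
      ext e
      rw [Finset.mem_filter, Finset.mem_Icc, Finset.mem_Icc, hcount P h1 h3]
      omega
    rw [this, Nat.card_Icc, Nat.add_sub_cancel]
  rw [Finset.sum_congr rfl fun k _ => Finset.sum_congr rfl (hinner k)]
  have hdisj : ((Finset.Icc 1 n : Finset ℕ) : Set ℕ).PairwiseDisjoint (monicIrredFinset K) := by
    intro i _ j _ hij
    refine Finset.disjoint_left.2 fun P hi hj => hij ?_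
    rw [← (mem_monicIrredFinset.1 hi).2.1, ← (mem_monicIrredFinset.1 hj).2.1]
  rw [← Finset.sum_biUnion hdisj]
  conv_rhs => rw [hsum]
  symm
  refine Finset.sum_subset ?_ ?_
  · intro P hP
    have hP' := Multiset.mem_toFinset.1 hP
    obtain ⟨h1, h2, h3⟩ := hNm P hP'
    refine Finset.mem_biUnion.2 ⟨P.natDegree, Finset.mem_Icc.2 ⟨h2.natDegree_pos, ?_⟩,
      mem_monicIrredFinset.2 ⟨h1, rfl, h2⟩⟩
    rw [← hdeg]; exact natDegree_le_of_dvd h3 hg0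
  · intro P _ hP
    rw [Multiset.count_eq_zero_of_notMem fun h => hP (Multiset.mem_toFinset.2 h), zero_mul]

/-- The coefficients of the `L`-function attached to a completely multiplicative function. -/
noncomputable def lCoeff {K : Type*} [Field K] [Finite K] (lam : K[X] →* ℂ) (n : ℕ) : ℂ :=
  ∑ g ∈ monicFinset K n, lam g

/-- The coefficients of the logarithmic derivative of the `L`-function attached to a completely
multiplicative function. -/
noncomputable def lPowerSum {K : Type*} [Field K] [Finite K] (lam : K[X] →* ℂ) (n : ℕ) : ℂ :=
  ∑ k ∈ n.divisors, ∑ P ∈ monicIrredFinset K k, k * lam P ^ (n / k)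

open Classical in
theorem sum_monicFinset_pow_dvd {K : Type*} [Field K] [Finite K] (lam : K[X] →* ℂ) {n k e : ℕ}
    {P : K[X]} (hP : P ∈ monicIrredFinset K k) :
    ∑ g ∈ monicFinset K n, (if P ^ e ∣ g then lam g else 0) =
      if k * e ≤ n then lam P ^ e * lCoeff lam (n - k * e) else 0 := by
  obtain ⟨h1, h2, h3⟩ := mem_monicIrredFinset.1 hP
  have hmon : (P ^ e).Monic := h1.pow e
  have hdeg : (P ^ e).natDegree = k * e := by rw [natDegree_pow, h2, mul_comm]
  rw [← Finset.sum_filter]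
  split_ifs with hle
  · rw [lCoeff, Finset.mul_sum]
    symm
    refine Finset.sum_bij (fun g _ => P ^ e * g) ?_ ?_ ?_ ?_
    · intro g hg
      obtain ⟨hg1, hg2⟩ := mem_monicFinset.1 hg
      refine Finset.mem_filter.2 ⟨mem_monicFinset.2 ⟨hmon.mul hg1, ?_⟩, Dvd.intro _ rfl⟩
      rw [hmon.natDegree_mul hg1, hdeg, hg2]; omega
    · intro a _ b _ hab
      exact mul_left_cancel₀ hmon.ne_zero hab
    · intro g hg
      obtain ⟨hg0, t, rfl⟩ := Finset.mem_filter.1 hg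
      obtain ⟨hg1, hg2⟩ := mem_monicFinset.1 hg0
      have ht := hmon.of_mul_monic_left hg1
      refine ⟨t, mem_monicFinset.2 ⟨ht, ?_⟩, rfl⟩
      rw [hmon.natDegree_mul ht, hdeg] at hg2
      omega
    · intro g _
      rw [map_mul, map_pow]
  · refine Finset.sum_eq_zero fun g hg => ?_
    exfalso
    obtain ⟨hg0, hd⟩ := Finset.mem_filter.1 hg
    obtain ⟨hg1, hg2⟩ := mem_monicFinset.1 hg0
    have := natDegree_le_of_dvd hd hg1.ne_zero
    omega

/-- Newton's identities for the `L`-function of a completely multiplicative function. -/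
theorem natCast_mul_lCoeff {K : Type*} [Field K] [Finite K] (lam : K[X] →* ℂ) (n : ℕ) :
    n * lCoeff lam n = ∑ i ∈ Finset.Icc 1 n, lPowerSum lam i * lCoeff lam (n - i) := by
  classical
  have h1 : (n : ℂ) * lCoeff lam n = ∑ k ∈ Finset.Icc 1 n, ∑ P ∈ monicIrredFinset K k,
      ∑ e ∈ Finset.Icc 1 n, ∑ g ∈ monicFinset K n, (k : ℂ) * (if P ^ e ∣ g then lam g else 0) := by
    have : (n : ℂ) * lCoeff lam n = ∑ g ∈ monicFinset K n, ∑ k ∈ Finset.Icc 1 n,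
        ∑ P ∈ monicIrredFinset K k, ∑ e ∈ Finset.Icc 1 n,
          (k : ℂ) * (if P ^ e ∣ g then lam g else 0) := by
      rw [lCoeff, Finset.mul_sum]
      refine Finset.sum_congr rfl fun g hg => ?_
      conv_lhs => rw [← sum_natDegree_irred_pow_dvd hg]
      push_cast
      simp_rw [Finset.sum_mul]
      refine Finset.sum_congr rfl fun k _ => Finset.sum_congr rfl fun P _ =>
        Finset.sum_congr rfl fun e _ => ?_
      split_ifs <;> simp
    rw [this, Finset.sum_comm]
    refine Finset.sum_congr rfl fun k _ => ?_
    rw [Finset.sum_comm]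
    refine Finset.sum_congr rfl fun P _ => ?_
    rw [Finset.sum_comm]
  have h2 : (n : ℂ) * lCoeff lam n = ∑ k ∈ Finset.Icc 1 n, ∑ e ∈ Finset.Icc 1 n,
      if k * e ≤ n then (∑ P ∈ monicIrredFinset K k, (k : ℂ) * lam P ^ e) * lCoeff lam (n - k * e)
        else 0 := by
    rw [h1]
    refine Finset.sum_congr rfl fun k _ => ?_
    rw [Finset.sum_comm]
    refine Finset.sum_congr rfl fun e _ => ?_
    rw [Finset.sum_congr rfl fun P hP => by
      rw [← Finset.mul_sum, sum_monicFinset_pow_dvd lam hP]]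
    split_ifs
    · rw [Finset.sum_mul]
      exact Finset.sum_congr rfl fun P _ => (mul_assoc _ _ _).symm
    · simp
  rw [h2, ← Finset.sum_product', ← Finset.sum_filter]
  have h3 : ∑ i ∈ Finset.Icc 1 n, lPowerSum lam i * lCoeff lam (n - i) =
      ∑ i ∈ Finset.Icc 1 n, ∑ k ∈ i.divisors,
        (∑ P ∈ monicIrredFinset K k, (k : ℂ) * lam P ^ (i / k)) * lCoeff lam (n - i) :=
    Finset.sum_congr rfl fun i _ => by rw [lPowerSum, Finset.sum_mul]
  rw [h3, Finset.sum_sigma']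
  refine Finset.sum_nbij' (fun x => ⟨x.1 * x.2, x.1⟩) (fun y => (y.2, y.1 / y.2)) ?_ ?_ ?_ ?_ ?_
  · rintro ⟨k, e⟩ h
    simp only [Finset.mem_filter, Finset.mem_product, Finset.mem_Icc] at h
    simp only [Finset.mem_sigma, Finset.mem_Icc, Nat.mem_divisors]
    obtain ⟨⟨⟨h1, -⟩, h2, -⟩, h3⟩ := h
    have : 0 < k * e := Nat.mul_pos h1 h2
    exact ⟨⟨this, h3⟩, Dvd.intro _ rfl, this.ne'⟩
  · rintro ⟨i, k⟩ h
    simp only [Finset.mem_sigma, Finset.mem_Icc, Nat.mem_divisors] at h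
    simp only [Finset.mem_filter, Finset.mem_product, Finset.mem_Icc]
    obtain ⟨⟨h1, h2⟩, ⟨e, rfl⟩, h3⟩ := h
    have hk : 0 < k := Nat.pos_of_mul_pos_right h1
    have he : 0 < e := Nat.pos_of_mul_pos_left h1
    rw [Nat.mul_div_cancel_left _ hk]
    exact ⟨⟨⟨hk, (Nat.le_mul_of_pos_right _ he).trans h2⟩, he,
      (Nat.le_mul_of_pos_left _ hk).trans h2⟩, h2⟩
  · rintro ⟨k, e⟩ h
    simp only [Finset.mem_filter, Finset.mem_product, Finset.mem_Icc] at h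
    simp only [Nat.mul_div_cancel_left _ h.1.1.1]
  · rintro ⟨i, k⟩ h
    simp only [Finset.mem_sigma, Finset.mem_Icc, Nat.mem_divisors] at h
    simp only [Nat.mul_div_cancel' h.2.1]
  · rintro ⟨k, e⟩ h
    simp only [Finset.mem_filter, Finset.mem_product, Finset.mem_Icc] at h
    simp only [Nat.mul_div_cancel_left _ h.1.1.1]

end Polynomial

namespace Polynomial

theorem norm_algebraMap_sub_eq {K L : Type*} [Field K] [Field L] [Algebra K L]
    [FiniteDimensional K L] (c : K) (x : L) :
    Algebra.norm K (algebraMap K L c - x) =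
      (minpoly K x).eval c ^ (Module.finrank K L / (minpoly K x).natDegree) := by
  set y := algebraMap K L c - x with hy
  have hyint : IsIntegral K y := Algebra.IsIntegral.isIntegral y
  have hmin : minpoly K y = (-1) ^ (minpoly K x).natDegree *
      ((minpoly K x).comp (X + C c)).comp (-X) := by
    rw [hy, ← neg_sub, minpoly.neg, minpoly.sub_algebraMap, natDegree_comp, natDegree_X_add_C,
      mul_one]
  have hdeg : (minpoly K y).natDegree = (minpoly K x).natDegree := by
    rw [hmin, ← C_1, ← C_neg, ← C_pow, natDegree_C_mul, natDegree_comp, natDegree_comp,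
      natDegree_X_add_C, natDegree_neg, natDegree_X, mul_one, mul_one]
    exact pow_ne_zero _ (by simp)
  rw [Algebra.norm_eq_norm_adjoin K y]
  have h1 := Algebra.PowerBasis.norm_gen_eq_coeff_zero_minpoly
    (IntermediateField.adjoin.powerBasis hyint)
  rw [IntermediateField.adjoin.powerBasis_gen, IntermediateField.minpoly_gen,
    IntermediateField.adjoin.powerBasis_dim] at h1
  rw [h1, hdeg]
  congr 1
  · rw [hmin, coeff_zero_eq_eval_zero, eval_mul, eval_pow, eval_neg, eval_one, ← mul_assoc,
      ← mul_pow, neg_one_mul, neg_neg, one_pow, one_mul, eval_comp, eval_comp]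
    simp
  · have h2 := Module.finrank_mul_finrank K (IntermediateField.adjoin K {y}) L
    rw [IntermediateField.adjoin.finrank hyint, hdeg] at h2
    rw [← h2, Nat.mul_div_cancel_left]
    exact minpoly.natDegree_pos (Algebra.IsIntegral.isIntegral x)

theorem sum_comp_minpoly_eq {K L : Type*} [Field K] [Finite K] [Field L] [Fintype L] [Algebra K L]
    (h : K[X] → ℂ) :
    ∑ x : L, h (minpoly K x) =
      ∑ k ∈ (Module.finrank K L).divisors, ∑ P ∈ monicIrredFinset K k, k * h P := by
  classical
  have := Fintype.ofFinite K
  have hn : 0 < Module.finrank K L := Module.finrank_pos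
  have hdisj : (((Module.finrank K L).divisors : Finset ℕ) : Set ℕ).PairwiseDisjoint
      (monicIrredFinset K) := by
    intro i _ j _ hij
    refine Finset.disjoint_left.2 fun P hi hj => hij ?_
    rw [← (mem_monicIrredFinset.1 hi).2.1, ← (mem_monicIrredFinset.1 hj).2.1]
  have hmaps : ∀ x ∈ (Finset.univ : Finset L), minpoly K x ∈
      (Module.finrank K L).divisors.biUnion (monicIrredFinset K) := by
    intro x _
    have hx := Algebra.IsIntegral.isIntegral (R := K) x
    exact Finset.mem_biUnion.2 ⟨_, Nat.mem_divisors.2 ⟨minpoly.degree_dvd hx, hn.ne'⟩,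
      mem_monicIrredFinset.2 ⟨minpoly.monic hx, rfl, minpoly.irreducible hx⟩⟩
  rw [← Finset.sum_fiberwise_of_maps_to hmaps, Finset.sum_biUnion hdisj]
  refine Finset.sum_congr rfl fun k hk => Finset.sum_congr rfl fun P hP => ?_
  obtain ⟨h1, h2, h3⟩ := mem_monicIrredFinset.1 hP
  rw [Finset.sum_congr rfl fun x hx => by rw [(Finset.mem_filter.1 hx).2], Finset.sum_const,
    nsmul_eq_mul]
  congr 2
  have hsplit : (map (algebraMap K L) P).Splits := by
    have h4 : P ∣ X ^ (Nat.card K) ^ (Module.finrank K L) - X :=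
      h3.natDegree_dvd_iff_dvd_X_pow_card_pow_sub_X.1 (by rw [h2]; exact Nat.dvd_of_mem_divisors hk)
    have h5 := FiniteField.isSplittingField_sub L K
    rw [← Module.natCard_eq_pow_finrank, Nat.card_eq_fintype_card] at h4
    refine Splits.of_dvd h5.splits ?_ (map_dvd _ h4)
    refine map_monic_ne_zero (monic_X_pow_sub ?_)
    rw [degree_X]
    exact_mod_cast Fintype.one_lt_card
  rw [← h2, ← card_rootSet_eq_natDegree (PerfectField.separable_of_irreducible h3) hsplit,
    ← Set.toFinset_card]
  congr 1
  ext x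
  rw [Finset.mem_filter, Set.mem_toFinset, mem_rootSet]
  constructor
  · rintro ⟨-, rfl⟩; exact ⟨h3.ne_zero, minpoly.aeval _ _⟩
  · rintro ⟨-, hx⟩; exact ⟨Finset.mem_univ _, (minpoly.eq_of_irreducible_of_monic h3 hx h1).symm⟩

/-- The completely multiplicative function `g ↦ ∏ i, χ i (g (c i))`. -/
noncomputable def charEvalHom {K : Type*} [Field K] {ι : Type*} [Fintype ι] (c : ι → K)
    (χ : ι → MulChar K ℂ) : K[X] →* ℂ where
  toFun g := ∏ i, χ i (g.eval (c i))
  map_one' := by simp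
  map_mul' f g := by simp [Finset.prod_mul_distrib]

theorem charEvalHom_apply {K : Type*} [Field K] {ι : Type*} [Fintype ι] (c : ι → K)
    (χ : ι → MulChar K ℂ) (g : K[X]) : charEvalHom c χ g = ∏ i, χ i (g.eval (c i)) := rfl

theorem lPowerSum_charEvalHom {K : Type*} [Field K] [Finite K] {ι : Type*} [Fintype ι] (c : ι → K)
    (χ : ι → MulChar K ℂ) (L : Type*) [Field L] [Fintype L] [Algebra K L] :
    lPowerSum (charEvalHom c χ) (Module.finrank K L) =
      ∑ x : L, ∏ i, χ i (Algebra.norm K (algebraMap K L (c i) + x)) := by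
  rw [← Equiv.sum_comp (Equiv.neg L)]
  simp only [Equiv.neg_apply, ← sub_eq_add_neg, norm_algebraMap_sub_eq]
  have := sum_comp_minpoly_eq (K := K) (L := L)
    (fun P => charEvalHom c χ P ^ (Module.finrank K L / P.natDegree))
  rw [lPowerSum]
  simp only [map_pow, Finset.prod_pow]
  refine Eq.trans ?_ this.symm
  exact Finset.sum_congr rfl fun k _ => Finset.sum_congr rfl fun P hP => by
    rw [(mem_monicIrredFinset.1 hP).2.1]

theorem lCoeff_charEvalHom_eq_zero {K : Type*} [Field K] [Finite K] {ι : Type*} [Fintype ι]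
    {c : ι → K} (hc : Function.Injective c) {χ : ι → MulChar K ℂ} (hχ : ∃ i, χ i ≠ 1) {n : ℕ}
    (hn : Fintype.card ι ≤ n) : lCoeff (charEvalHom c χ) n = 0 := by
  classical
  obtain ⟨i₀, hi₀⟩ := hχ
  obtain ⟨a, ha⟩ := MulChar.ne_one_iff.1 hi₀
  set l := Lagrange.basis Finset.univ c i₀ with hl
  have hl1 : l.eval (c i₀) = 1 := Lagrange.eval_basis_self hc.injOn (Finset.mem_univ _)
  have hl0 : ∀ i, i ≠ i₀ → l.eval (c i) = 0 := fun i hi =>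
    Lagrange.eval_basis_of_ne hi.symm (Finset.mem_univ _)
  have hldeg : l.degree < n := by
    rw [hl, Lagrange.degree_basis hc.injOn (Finset.mem_univ _), Finset.card_univ]
    have : 0 < Fintype.card ι := Fintype.card_pos_iff.2 ⟨i₀⟩
    exact_mod_cast (by omega)
  set T : K[X] → K[X] := fun g => g + C (((a : K) - 1) * g.eval (c i₀)) * l with hT
  have hT0 : ∀ g, (T g).eval (c i₀) = a * g.eval (c i₀) := fun g => by
    simp only [hT, eval_add, eval_mul, eval_C, hl1]; ring
  have hT1 : ∀ g i, i ≠ i₀ → (T g).eval (c i) = g.eval (c i) := fun g i hi => by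
    simp [hT, hl0 i hi]
  have hmaps : ∀ g ∈ monicFinset K n, T g ∈ monicFinset K n := by
    intro g hg
    obtain ⟨h1, h2⟩ := mem_monicFinset.1 hg
    have h3 : (C (((a : K) - 1) * g.eval (c i₀)) * l).degree < g.degree := by
      rw [degree_eq_natDegree h1.ne_zero, h2]
      refine (degree_mul_le _ _).trans_lt ?_
      refine lt_of_le_of_lt (add_le_add_left degree_C_le _) ?_
      rwa [zero_add]
    refine mem_monicFinset.2 ⟨h1.add_of_left h3, ?_⟩
    rw [hT]
    simp only
    rw [natDegree_add_eq_left_of_degree_lt h3, h2]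
  have hinj : Set.InjOn T (monicFinset K n) := by
    intro g _ g' _ h
    have h1 := congrArg (eval (c i₀)) h
    rw [hT0, hT0] at h1
    have h2 := mul_left_cancel₀ a.ne_zero h1
    simp only [hT, h2] at h
    exact add_right_cancel h
  have hsum : ∑ g ∈ monicFinset K n, charEvalHom c χ (T g) = lCoeff (charEvalHom c χ) n :=
    Finset.sum_nbij T hmaps hinj (Finset.surjOn_of_injOn_of_card_le T hmaps hinj le_rfl)
      fun _ _ => rfl
  have hval : ∀ g, charEvalHom c χ (T g) = χ i₀ a * charEvalHom c χ g := by
    intro g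
    rw [charEvalHom_apply, charEvalHom_apply, ← Finset.mul_prod_erase _ _ (Finset.mem_univ i₀),
      ← Finset.mul_prod_erase _ (fun i => χ i (g.eval (c i))) (Finset.mem_univ i₀), hT0, map_mul,
      mul_assoc]
    congr 2
    exact Finset.prod_congr rfl fun i hi => by rw [hT1 g i (Finset.ne_of_mem_erase hi)]
  simp_rw [hval] at hsum
  rw [← Finset.mul_sum] at hsum
  change χ i₀ a * lCoeff (charEvalHom c χ) n = _ at hsum
  have h4 : (χ i₀ a - 1) * lCoeff (charEvalHom c χ) n = 0 := by rw [sub_mul, hsum, one_mul, sub_self]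
  exact (mul_eq_zero.1 h4).resolve_left (sub_ne_zero.2 ha)

end Polynomial

theorem le_one_of_pow_le {x B : ℝ} (h : ∀ k : ℕ, 1 ≤ k → x ^ k ≤ B) : x ≤ 1 := by
  by_contra! hx
  obtain ⟨k, hk⟩ := pow_unbounded_of_one_lt B hx
  have h1 : x ^ k ≤ x ^ (k + 1) := pow_le_pow_right₀ hx.le (Nat.le_succ k)
  linarith [h (k + 1) (by omega)]

theorem norm_le_one_of_norm_pow_add_pow_le {u v : ℂ} {C : ℝ}
    (h : ∀ k : ℕ, 1 ≤ k → ‖u ^ k + v ^ k‖ ≤ C) : ‖u‖ ≤ 1 := by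
  have huv : ∀ k : ℕ, 1 ≤ k → ‖(u * v) ^ k‖ ≤ (C ^ 2 + C) / 2 := by
    intro k hk
    have h1 : (u * v) ^ k = ((u ^ k + v ^ k) ^ 2 - (u ^ (2 * k) + v ^ (2 * k))) / 2 := by
      rw [pow_mul', pow_mul']; ring
    rw [h1, norm_div, Complex.norm_two]
    have h2 := h k hk
    have h3 := h (2 * k) (by omega)
    have h4 := norm_sub_le ((u ^ k + v ^ k) ^ 2) (u ^ (2 * k) + v ^ (2 * k))
    rw [norm_pow] at h4
    have h5 := pow_le_pow_left₀ (norm_nonneg _) h2 2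
    linarith
  refine le_one_of_pow_le (B := C + (C ^ 2 + C) / 2 + 1) fun k hk => ?_
  have hC : 0 ≤ C := (norm_nonneg _).trans (h k hk)
  have h1 : u ^ k * u ^ k = u ^ k * (u ^ k + v ^ k) - (u * v) ^ k := by ring
  have h2 := norm_sub_le (u ^ k * (u ^ k + v ^ k)) ((u * v) ^ k)
  rw [← h1, norm_mul, norm_mul, norm_pow] at h2
  have h3 := huv k hk
  have h4 := mul_le_mul_of_nonneg_left (h k hk) (norm_nonneg (u ^ k))
  rw [norm_pow] at h4
  by_contra! h5
  nlinarith [sq_nonneg C, pow_nonneg (norm_nonneg u) k]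

section

open Polynomial

/-- The Weil bound for character sums of three linear polynomials. -/
theorem norm_sum_prod_mulChar_le {K : Type*} [Field K] [Fintype K] {c : Fin 3 → K}
    (hc : Function.Injective c) {χ : Fin 3 → MulChar K ℂ} (hχ : ∃ i, χ i ≠ 1) :
    ‖∑ x : K, ∏ i, χ i (c i + x)‖ ≤ 2 * √(Fintype.card K) := by
  set lam := charEvalHom c χ with hlam
  set S := lPowerSum lam with hS
  set c₁ := lCoeff lam 1
  set c₂ := lCoeff lam 2
  have hc0 : lCoeff lam 0 = 1 := by rw [lCoeff, monicFinset_zero, Finset.sum_singleton, map_one]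
  have hc3 : ∀ n, 3 ≤ n → lCoeff lam n = 0 := fun n hn =>
    lCoeff_charEvalHom_eq_zero hc hχ (by simpa using hn)
  obtain ⟨s, hs⟩ := IsAlgClosed.exists_pow_nat_eq (c₁ ^ 2 - 4 * c₂) (n := 2) (by norm_num)
  obtain ⟨α, hα⟩ : ∃ α, α = (-c₁ + s) / 2 := ⟨_, rfl⟩
  obtain ⟨β, hβ⟩ : ∃ β, β = (-c₁ - s) / 2 := ⟨_, rfl⟩
  have hadd : c₁ = -(α + β) := by rw [hα, hβ]; ring
  have hmul : c₂ = α * β := by rw [hα, hβ]; linear_combination hs / 4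
  have hS1 : S 1 = -(α + β) := by
    have h := natCast_mul_lCoeff lam 1
    simp only [Finset.Icc_self, Finset.sum_singleton, Nat.sub_self, hc0] at h
    rw [← hadd]
    simpa using h.symm
  have hS2 : S 2 = -(α ^ 2 + β ^ 2) := by
    have h := natCast_mul_lCoeff lam 2
    rw [show Finset.Icc 1 2 = {1, 2} by rfl, Finset.sum_pair (by norm_num)] at h
    simp only [Nat.sub_self, hc0, show 2 - 1 = 1 from rfl] at h
    change ((2 : ℕ) : ℂ) * c₂ = S 1 * c₁ + S 2 * 1 at h
    rw [hS1, hadd, hmul] at h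
    push_cast at h
    linear_combination -h
  have hrec : ∀ n, S (n + 3) = -(S (n + 2) * c₁ + S (n + 1) * c₂) := by
    intro n
    have h := natCast_mul_lCoeff lam (n + 3)
    rw [hc3 _ (by omega), mul_zero] at h
    rw [Finset.sum_Icc_succ_top (by omega), Finset.sum_Icc_succ_top (by omega),
      Finset.sum_Icc_succ_top (by omega), Finset.sum_eq_zero] at h
    · rw [Nat.sub_self, hc0, show n + 3 - (n + 1) = 2 by omega,
        show n + 3 - (n + 1 + 1) = 1 by omega] at h
      change 0 = 0 + S (n + 1) * c₂ + S (n + 2) * c₁ + S (n + 3) * 1 at h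
      linear_combination -h
    · intro i hi
      rw [Finset.mem_Icc] at hi
      rw [hc3 _ (by omega), mul_zero]
  have hSn : ∀ n, S (n + 1) = -(α ^ (n + 1) + β ^ (n + 1)) ∧
      S (n + 2) = -(α ^ (n + 2) + β ^ (n + 2)) := by
    intro n
    induction n with
    | zero => exact ⟨by simpa using hS1, by simpa using hS2⟩
    | succ n ih =>
      refine ⟨ih.2, ?_⟩
      rw [show n + 1 + 2 = n + 3 by rfl, hrec, ih.1, ih.2, hadd, hmul]
      ring
  obtain ⟨A, hA⟩ := MulChar.exists_norm_sum_prod_norm_le hc hχ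
  set q := Fintype.card K
  have hq : 0 < q := Fintype.card_pos
  have hq' : (0 : ℝ) < q := by exact_mod_cast hq
  obtain ⟨p, hp⟩ := CharP.exists K
  have : Fact p.Prime := ⟨CharP.char_is_prime K p⟩
  have hbound : ∀ k : ℕ, 1 ≤ k → ‖α ^ (2 * k) + β ^ (2 * k)‖ ≤ A * (q : ℝ) ^ k := by
    intro k hk
    have : NeZero (2 * k) := ⟨by omega⟩
    let _ := Fintype.ofFinite (FiniteField.Extension K p (2 * k))
    have hfin := FiniteField.finrank_extension K p (2 * k)
    have h1 := hA k (FiniteField.Extension K p (2 * k)) hfin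
    rw [← lPowerSum_charEvalHom, hfin] at h1
    have h2 := (hSn (2 * k - 1)).1
    rw [show 2 * k - 1 + 1 = 2 * k by omega] at h2
    change ‖S (2 * k)‖ ≤ _ at h1
    rwa [h2, norm_neg] at h1
  have hb2 : ∀ k : ℕ, 1 ≤ k → ‖(α ^ 2 / q) ^ k + (β ^ 2 / q) ^ k‖ ≤ A := by
    intro k hk
    rw [div_pow, div_pow, ← add_div, ← pow_mul, ← pow_mul, norm_div, norm_pow,
      Complex.norm_natCast, div_le_iff₀ (by positivity)]
    exact hbound k hk
  have hroot : ∀ z : ℂ, ‖z ^ 2 / q‖ ≤ 1 → ‖z‖ ≤ √q := by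
    intro z hz
    rw [norm_div, Complex.norm_natCast, div_le_one hq', norm_pow] at hz
    exact Real.le_sqrt_of_sq_le hz
  have hα1 := hroot α (norm_le_one_of_norm_pow_add_pow_le hb2)
  have hβ1 := hroot β (norm_le_one_of_norm_pow_add_pow_le fun k hk => by
    rw [add_comm]; exact hb2 k hk)
  have hfinal : ∑ x : K, ∏ i, χ i (c i + x) = S 1 := by
    have h := lPowerSum_charEvalHom c χ K
    rw [Module.finrank_self] at h
    rw [hS, hlam, h]
    simp
  rw [hfinal, hS1, norm_neg]
  linarith [norm_add_le α β]

end

open Classical in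
noncomputable instance MulChar.instFintypeComplex (F : Type*) [Field F] [Fintype F] :
    Fintype (MulChar F ℂ) := Fintype.ofFinite _

/-- The function `φ` is a combination of multiplicative characters of exponent `m`, with `t` the
coefficient of the trivial character, and coefficients of total size at most `A`. -/
def IsCharExpansion {F : Type*} [Field F] [Fintype F] (m : ℕ) (φ : F → ℂ) (t : ℂ) (A : ℝ) : Prop :=
  ∃ c : MulChar F ℂ → ℂ, (∀ g, φ g = ∑ χ, c χ * χ g) ∧ c 1 = t ∧ ∑ χ, ‖c χ‖ ≤ A ∧
    ∀ χ, c χ ≠ 0 → χ ^ m = 1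

namespace IsCharExpansion

variable {F : Type*} [Field F] [Fintype F]

open Classical in
theorem one : IsCharExpansion 1 (fun g : F => if g ≠ 0 then 1 else 0) 1 1 := by
  refine ⟨fun χ => if χ = 1 then 1 else 0, fun g => ?_, if_pos rfl, ?_, fun χ h => ?_⟩
  · simp only [ite_mul, one_mul, zero_mul, Finset.sum_ite_eq', Finset.mem_univ, if_true]
    split_ifs with h
    · rw [MulChar.one_apply (isUnit_iff_ne_zero.2 h)]
    · rw [not_not.1 h, MulChar.map_zero]
  · simp [apply_ite norm]
  · rw [pow_one]
    by_contra h1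
    exact h (if_neg h1)

theorem mul {m m' : ℕ} {φ φ' : F → ℂ} {t t' : ℂ} {A A' : ℝ} (hm : m.Coprime m')
    (h : IsCharExpansion m φ t A) (h' : IsCharExpansion m' φ' t' A') :
    IsCharExpansion (m * m') (fun g => φ g * φ' g) (t * t') (A * A') := by
  classical
  obtain ⟨c, hc, hct, hcA, hcs⟩ := h
  obtain ⟨c', hc', hct', hcA', hcs'⟩ := h'
  refine ⟨fun χ => ∑ η, c η * c' (η⁻¹ * χ), fun g => ?_, ?_, ?_, fun χ hχ => ?_⟩
  · have h1 : ∑ χ, (∑ η, c η * c' (η⁻¹ * χ)) * χ g = ∑ η, ∑ χ, c η * c' (η⁻¹ * χ) * χ g := by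
      rw [Finset.sum_comm]
      exact Finset.sum_congr rfl fun χ _ => Finset.sum_mul _ _ _
    change φ g * φ' g = _
    rw [h1, hc, hc', Fintype.sum_mul_sum]
    refine Finset.sum_congr rfl fun η _ => ?_
    rw [← Equiv.sum_comp (Equiv.mulLeft η) fun χ => c η * c' (η⁻¹ * χ) * χ g]
    refine Finset.sum_congr rfl fun χ _ => ?_
    simp only [Equiv.coe_mulLeft, inv_mul_cancel_left, MulChar.mul_apply]
    ring
  · simp only [mul_one]
    rw [Finset.sum_eq_single 1, inv_one, hct, hct']
    · intro η _ hη
      by_contra hne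
      have h1 := hcs η (left_ne_zero_of_mul hne)
      have h2 := hcs' _ (right_ne_zero_of_mul hne)
      rw [inv_pow, inv_eq_one] at h2
      have h3 := Nat.dvd_gcd (orderOf_dvd_of_pow_eq_one h1) (orderOf_dvd_of_pow_eq_one h2)
      rw [hm, Nat.dvd_one, orderOf_eq_one_iff] at h3
      exact hη h3
    · intro h; exact absurd (Finset.mem_univ _) h
  · have hA' : 0 ≤ ∑ χ, ‖c' χ‖ := Finset.sum_nonneg fun _ _ => norm_nonneg _
    calc _ ≤ ∑ χ, ∑ η, ‖c η‖ * ‖c' (η⁻¹ * χ)‖ := Finset.sum_le_sum fun χ _ =>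
          norm_sum_le_of_le _ fun η _ => (norm_mul _ _).le
      _ = ∑ η, ‖c η‖ * ∑ χ, ‖c' χ‖ := by
          rw [Finset.sum_comm]
          refine Finset.sum_congr rfl fun η _ => ?_
          rw [← Finset.mul_sum, ← Equiv.sum_comp (Equiv.mulLeft η⁻¹) fun χ => ‖c' χ‖]
          rfl
      _ = (∑ η, ‖c η‖) * ∑ χ, ‖c' χ‖ := by rw [Finset.sum_mul]
      _ ≤ A * A' := mul_le_mul hcA hcA' hA'
          ((Finset.sum_nonneg fun _ _ => norm_nonneg _).trans hcA)
  · obtain ⟨η, -, hη⟩ := Finset.exists_ne_zero_of_sum_ne_zero hχ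
    have h1 := hcs η (left_ne_zero_of_mul hη)
    have h2 := hcs' _ (right_ne_zero_of_mul hη)
    rw [mul_pow, inv_pow, inv_mul_eq_one] at h2
    rw [mul_comm, pow_mul, ← h2, ← pow_mul, mul_comm, pow_mul, h1, one_pow]

variable {l : ℕ}

open Classical in
theorem card_mulChar_pow_eq_one (hl : l ∣ Fintype.card F - 1) :
    (Finset.univ.filter fun χ : MulChar F ℂ => χ ^ l = 1).card = l := by
  have e := (MulChar.mulEquiv_units F ℂ).some
  have hcyc : IsCyclic (MulChar F ℂ) := e.isCyclic.2 inferInstance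
  have h1 := IsCyclic.card_powMonoidHom_ker (MulChar F ℂ) l
  rw [Nat.card_congr e.toEquiv, Nat.card_eq_fintype_card,
    Nat.card_eq_fintype_card, Fintype.card_units, Nat.gcd_eq_right hl] at h1
  rw [← Fintype.card_subtype]
  conv_rhs => rw [← h1]
  exact Fintype.card_congr (Equiv.subtypeEquivRight fun χ => by
    rw [MonoidHom.mem_ker, powMonoidHom_apply])

open Classical in
theorem sum_mulChar_pow_eq_one (hl0 : 0 < l) (hl : l ∣ Fintype.card F - 1) (g : F) :
    ∑ χ ∈ (Finset.univ.filter fun χ : MulChar F ℂ => χ ^ l = 1), χ g =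
      if g ≠ 0 ∧ g ^ ((Fintype.card F - 1) / l) = 1 then (l : ℂ) else 0 := by
  set q := Fintype.card F with hq
  have hq1 : 0 < q - 1 := by have := Fintype.one_lt_card (α := F); omega
  split_ifs with h
  · obtain ⟨hg, hgl⟩ := h
    obtain ⟨γ, hγ⟩ := IsCyclic.exists_generator (α := Fˣ)
    obtain ⟨i, hi⟩ := mem_powers_iff_mem_zpowers.2 (hγ (Units.mk0 g hg))
    have hgi : (γ : F) ^ i = g := by simpa using congrArg Units.val hi
    have ho : orderOf γ = q - 1 := by
      rw [orderOf_eq_card_of_forall_mem_zpowers hγ, Nat.card_eq_fintype_card, Fintype.card_units]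
    have hli : l ∣ i := by
      rw [← hgi, ← pow_mul] at hgl
      have h1 : γ ^ (i * ((q - 1) / l)) = 1 := by ext; simpa using hgl
      have h2 := orderOf_dvd_of_pow_eq_one h1
      rw [ho] at h2
      nth_rewrite 1 [← Nat.mul_div_cancel' hl] at h2
      exact Nat.dvd_of_mul_dvd_mul_right (Nat.div_pos (Nat.le_of_dvd hq1 hl) hl0) h2
    obtain ⟨j, rfl⟩ := hli
    rw [Finset.sum_congr rfl fun χ hχ => ?_, Finset.sum_const, card_mulChar_pow_eq_one hl,
      nsmul_eq_mul, mul_one]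
    have hχ' := (Finset.mem_filter.1 hχ).2
    rw [← hgi, mul_comm, pow_mul, map_pow, ← MulChar.pow_apply' _ hl0.ne', hχ',
      MulChar.one_apply ((γ.isUnit).pow j)]
  · by_cases hg : g = 0
    · exact Finset.sum_eq_zero fun χ _ => by rw [hg, MulChar.map_zero]
    · have hgl : g ^ ((q - 1) / l) ≠ 1 := fun h1 => h ⟨hg, h1⟩
      obtain ⟨ψ, hψ⟩ := MulChar.exists_mulChar_orderOf F (n := q - 1) dvd_rfl
        (Complex.isPrimitiveRoot_exp (q - 1) hq1.ne')
      have hm0 : (q - 1) / l ≠ 0 := (Nat.div_pos (Nat.le_of_dvd hq1 hl) hl0).ne'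
      set η := ψ ^ ((q - 1) / l) with hη
      have hη1 : η g ≠ 1 := by
        rw [hη, MulChar.pow_apply' _ hm0, ← map_pow]
        intro h1
        have h2 := ψ.pow_div_orderOf_eq_one_of_apply_eq_one h1
        rw [hψ, Nat.div_self hq1, pow_one] at h2
        exact hgl h2
      have hηl : η ^ l = 1 := by
        rw [hη, ← pow_mul, Nat.div_mul_cancel hl, ← hψ, pow_orderOf_eq_one]
      set H := Finset.univ.filter fun χ : MulChar F ℂ => χ ^ l = 1
      have h1 : ∑ χ ∈ H, χ g = η g * ∑ χ ∈ H, χ g := by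
        rw [Finset.mul_sum]
        symm
        refine Finset.sum_nbij' (fun χ => η * χ) (fun χ => η⁻¹ * χ) ?_ ?_ ?_ ?_ ?_
        · intro χ hχ
          have := (Finset.mem_filter.1 hχ).2
          exact Finset.mem_filter.2 ⟨Finset.mem_univ _, by rw [mul_pow, hηl, this, one_mul]⟩
        · intro χ hχ
          have := (Finset.mem_filter.1 hχ).2
          exact Finset.mem_filter.2 ⟨Finset.mem_univ _, by
            rw [mul_pow, inv_pow, hηl, this, inv_one, one_mul]⟩
        · intro χ _; exact inv_mul_cancel_left _ _
        · intro χ _; exact mul_inv_cancel_left _ _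
        · intro χ _; rw [MulChar.mul_apply]
      have h2 : (1 - η g) * ∑ χ ∈ H, χ g = 0 := by rw [sub_mul, ← h1, one_mul, sub_self]
      exact (mul_eq_zero.1 h2).resolve_left (sub_ne_zero.2 hη1.symm)

open Classical in
theorem of_ite_pow_eq_one (hl0 : 0 < l) (hl : l ∣ Fintype.card F - 1) (a b : ℂ) :
    IsCharExpansion l (fun g : F => if g ≠ 0 then
        (if g ^ ((Fintype.card F - 1) / l) = 1 then a + b else b) else 0)
      (a / l + b) (‖a / l + b‖ + (1 - 1 / l) * ‖a‖) := by
  set H := Finset.univ.filter fun χ : MulChar F ℂ => χ ^ l = 1 with hH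
  have hlC : (l : ℂ) ≠ 0 := by exact_mod_cast hl0.ne'
  have hlR : (l : ℝ) ≠ 0 := by exact_mod_cast hl0.ne'
  have h1H : (1 : MulChar F ℂ) ∈ H := Finset.mem_filter.2 ⟨Finset.mem_univ _, one_pow _⟩
  refine ⟨fun χ => (if χ ∈ H then a / l else 0) + (if χ = 1 then b else 0), fun g => ?_, ?_, ?_,
    fun χ h => ?_⟩
  · simp only [add_mul, Finset.sum_add_distrib, ite_mul, zero_mul]
    rw [Finset.sum_ite_mem, Finset.univ_inter, ← Finset.mul_sum, hH,
      sum_mulChar_pow_eq_one hl0 hl, Finset.sum_ite_eq', if_pos (Finset.mem_univ _)]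
    by_cases hg : g = 0
    · simp [hg, MulChar.map_zero]
    · rw [MulChar.one_apply (isUnit_iff_ne_zero.2 hg)]
      by_cases h2 : g ^ ((Fintype.card F - 1) / l) = 1
      · simp [hg, h2, hlC]
      · simp [hg, h2]
  · simp [h1H]
  · rw [← Finset.add_sum_erase _ _ (Finset.mem_univ (1 : MulChar F ℂ))]
    have h2 : ∑ χ ∈ Finset.univ.erase (1 : MulChar F ℂ),
        ‖(if χ ∈ H then a / l else 0) + (if χ = 1 then b else 0)‖ =
        ∑ χ ∈ H.erase 1, ‖a‖ / l := by
      rw [← Finset.sum_subset (Finset.erase_subset_erase 1 (Finset.subset_univ H))]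
      · refine Finset.sum_congr rfl fun χ hχ => ?_
        rw [if_pos (Finset.mem_of_mem_erase hχ), if_neg (Finset.ne_of_mem_erase hχ), add_zero,
          norm_div, Complex.norm_natCast]
      · intro χ hχ hχ'
        have h3 := Finset.ne_of_mem_erase hχ
        rw [if_neg (fun h => hχ' (Finset.mem_erase.2 ⟨h3, h⟩)), if_neg h3, add_zero, norm_zero]
    rw [h2, Finset.sum_const, Finset.card_erase_of_mem h1H, card_mulChar_pow_eq_one hl]
    simp only [if_pos h1H, if_true]
    rw [nsmul_eq_mul, Nat.cast_sub hl0, Nat.cast_one]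
    refine le_of_eq ?_
    field_simp
  · by_cases h1 : χ ∈ H
    · exact (Finset.mem_filter.1 h1).2
    · simp only [if_neg h1, zero_add] at h
      by_cases h2 : χ = 1
      · rw [h2, one_pow]
      · exact absurd (if_neg h2) h

end IsCharExpansion

theorem IsCharExpansion.norm_sum_prod_sub_le {F : Type*} [Field F] [Fintype F] {c : Fin 3 → F}
    (hc : Function.Injective c) {m : Fin 3 → ℕ} {φ : Fin 3 → F → ℂ} {t : Fin 3 → ℂ} {A : Fin 3 → ℝ}
    (h : ∀ u, IsCharExpansion (m u) (φ u) (t u) (A u)) :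
    ‖∑ x, ∏ u, φ u (c u + x) - (∏ u, t u) * (Fintype.card F - 3)‖ ≤
      (∏ u, A u - ∏ u, ‖t u‖) * (2 * √(Fintype.card F)) := by
  classical
  choose b hb hbt hbA _ using h
  have h1 : ∑ x, ∏ u, φ u (c u + x) =
      ∑ χ : Fin 3 → MulChar F ℂ, (∏ u, b u (χ u)) * ∑ x, ∏ u, χ u (c u + x) := by
    simp_rw [hb, Fintype.prod_sum, Finset.prod_mul_distrib, Finset.mul_sum]
    rw [Finset.sum_comm]
  have h2 : ∑ x : F, ∏ u, (1 : Fin 3 → MulChar F ℂ) u (c u + x) = Fintype.card F - 3 := by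
    have h3 : ∀ x : F, ∏ u, (1 : Fin 3 → MulChar F ℂ) u (c u + x) =
        if x ∈ Finset.univ.image (fun u => -c u) then 0 else 1 := by
      intro x
      split_ifs with hx
      · obtain ⟨u, -, rfl⟩ := Finset.mem_image.1 hx
        exact Finset.prod_eq_zero (Finset.mem_univ u) (by
          rw [add_neg_cancel, Pi.one_apply, MulChar.map_zero])
      · refine Finset.prod_eq_one fun u _ => ?_
        rw [Pi.one_apply, MulChar.one_apply]
        refine isUnit_iff_ne_zero.2 fun h0 => hx ?_
        exact Finset.mem_image.2 ⟨u, Finset.mem_univ _, neg_eq_of_add_eq_zero_right h0⟩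
    have h4 : (Finset.univ.image fun u => -c u).card = 3 := by
      rw [Finset.card_image_of_injective Finset.univ (f := fun u => -c u)
        fun a b h => hc (neg_injective h), Finset.card_univ, Fintype.card_fin]
    have h5 : ∀ x : F, (if x ∈ Finset.univ.image (fun u => -c u) then (0 : ℂ) else 1) =
        1 - if x ∈ Finset.univ.image (fun u => -c u) then 1 else 0 := fun x => by split_ifs <;> simp
    simp_rw [h3, h5]
    rw [Finset.sum_sub_distrib, Finset.sum_ite_mem, Finset.univ_inter, Finset.sum_const,
      Finset.sum_const, h4, Finset.card_univ]
    simp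
  rw [h1, ← Finset.add_sum_erase _ _ (Finset.mem_univ (1 : Fin 3 → MulChar F ℂ)), h2]
  simp only [Pi.one_apply, hbt, add_sub_cancel_left]
  have h6 : ∏ u, ∑ χ, ‖b u χ‖ = ∏ u, ‖t u‖ +
      ∑ χ ∈ Finset.univ.erase (1 : Fin 3 → MulChar F ℂ), ∏ u, ‖b u (χ u)‖ := by
    rw [Fintype.prod_sum, ← Finset.add_sum_erase _ _ (Finset.mem_univ (1 : Fin 3 → MulChar F ℂ))]
    simp only [Pi.one_apply, hbt]
  have h7 : ∏ u, ∑ χ, ‖b u χ‖ ≤ ∏ u, A u :=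
    Finset.prod_le_prod (fun _ _ => Finset.sum_nonneg fun _ _ => norm_nonneg _) fun u _ => hbA u
  calc _ ≤ ∑ χ ∈ Finset.univ.erase (1 : Fin 3 → MulChar F ℂ),
        (∏ u, ‖b u (χ u)‖) * (2 * √(Fintype.card F)) := by
        refine norm_sum_le_of_le _ fun χ hχ => ?_
        rw [norm_mul, norm_prod]
        refine mul_le_mul_of_nonneg_left (norm_sum_prod_mulChar_le hc ?_)
          (Finset.prod_nonneg fun _ _ => norm_nonneg _)
        by_contra! hall
        exact Finset.ne_of_mem_erase hχ (funext hall)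
    _ ≤ _ := by
        rw [← Finset.sum_mul]
        exact mul_le_mul_of_nonneg_right (by linarith) (by positivity)

open Classical in
/-- The indicator function of the nonzero elements which are not `l`-th powers, for any `l` in a
given finite set. -/
noncomputable def freeIndicator {F : Type*} [Field F] [Fintype F] (C : Finset ℕ) (g : F) : ℝ :=
  if g ≠ 0 ∧ ∀ l ∈ C, g ^ ((Fintype.card F - 1) / l) ≠ 1 then 1 else 0

open Classical in
/-- The balanced indicator function of the nonzero `l`-th powers. -/
noncomputable def balancedPowerIndicator {F : Type*} [Field F] [Fintype F] (l : ℕ) (g : F) : ℝ :=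
  if g ≠ 0 then (if g ^ ((Fintype.card F - 1) / l) = 1 then 1 - 1 / l else -(1 / l)) else 0

section

variable {F : Type*} [Field F] [Fintype F]

theorem isCharExpansion_freeIndicator {C : Finset ℕ}
    (hC : ∀ l ∈ C, l.Prime ∧ l ∣ Fintype.card F - 1) :
    IsCharExpansion (∏ l ∈ C, l) (fun g : F => (freeIndicator C g : ℂ))
      ((∏ l ∈ C, (1 - 1 / (l : ℝ)) : ℝ) : ℂ) (2 ^ C.card * ∏ l ∈ C, (1 - 1 / (l : ℝ))) := by
  classical
  induction C using Finset.induction_on with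
  | empty =>
    convert IsCharExpansion.one (F := F) using 1
    · simp
    · ext g
      simp only [freeIndicator, Finset.notMem_empty, false_imp_iff, implies_true, and_true]
      split_ifs <;> simp_all
    · simp
    · simp
  | insert l C hl ih =>
    obtain ⟨hlp, hlq⟩ := hC l (Finset.mem_insert_self _ _)
    have ih' := ih fun k hk => hC k (Finset.mem_insert_of_mem hk)
    have hcop : (∏ k ∈ C, k).Coprime l := Nat.Coprime.prod_left fun k hk =>
      (Nat.coprime_primes (hC k (Finset.mem_insert_of_mem hk)).1 hlp).2 fun h => hl (h ▸ hk)
    have h1 := ih'.mul hcop (IsCharExpansion.of_ite_pow_eq_one (F := F) hlp.pos hlq (-1) 1)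
    convert h1 using 1
    · rw [Finset.prod_insert hl, mul_comm]
    · ext g
      simp only [freeIndicator, Finset.forall_mem_insert]
      by_cases h0 : g = 0
      · simp [h0]
      · by_cases h2 : g ^ ((Fintype.card F - 1) / l) = 1
        · simp [h2]
        · simp [h0, h2]
    · rw [Finset.prod_insert hl]; push_cast; ring
    · have hl1 : (1 : ℝ) / l ≤ 1 := by
        rw [div_le_one (by exact_mod_cast hlp.pos)]; exact_mod_cast hlp.one_lt.le
      have h3 : ‖(-1 : ℂ) / l + 1‖ = 1 - 1 / (l : ℝ) := by
        rw [show (-1 : ℂ) / l + 1 = ((1 - 1 / (l : ℝ) : ℝ) : ℂ) by push_cast; ring,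
          Complex.norm_real, Real.norm_of_nonneg (by linarith)]
      rw [h3, Finset.prod_insert hl, Finset.card_insert_of_notMem hl, norm_neg, norm_one]
      ring

theorem isCharExpansion_freeIndicator_mul {C : Finset ℕ}
    (hC : ∀ l ∈ C, l.Prime ∧ l ∣ Fintype.card F - 1) {p : ℕ} (hp : p.Prime)
    (hpq : p ∣ Fintype.card F - 1) (hpC : p ∉ C) :
    IsCharExpansion ((∏ l ∈ C, l) * p)
      (fun g : F => ((freeIndicator C g * balancedPowerIndicator p g : ℝ) : ℂ))
      0 (2 ^ C.card * (∏ l ∈ C, (1 - 1 / (l : ℝ))) * (1 - 1 / p)) := by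
  classical
  have hcop : (∏ k ∈ C, k).Coprime p := Nat.Coprime.prod_left fun k hk =>
    (Nat.coprime_primes (hC k hk).1 hp).2 fun h => hpC (h ▸ hk)
  have h1 := (isCharExpansion_freeIndicator hC).mul hcop
    (IsCharExpansion.of_ite_pow_eq_one (F := F) hp.pos hpq 1 (-(1 / p)))
  convert h1 using 1
  · ext g
    simp only [balancedPowerIndicator]
    push_cast
    congr 1
    split_ifs <;> push_cast <;> ring
  · simp
  · simp

/-- The sieve inequality for triples of elements which are not `l`-th powers. -/
theorem exists_forall_pow_ne_one {c : Fin 3 → F} (hc : Function.Injective c) {C P : Finset ℕ}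
    (hCP : Disjoint C P) (hC : ∀ l ∈ C, l.Prime ∧ l ∣ Fintype.card F - 1)
    (hP : ∀ l ∈ P, l.Prime ∧ l ∣ Fintype.card F - 1) {δ : ℝ}
    (hδ : δ = 1 - 3 * ∑ p ∈ P, 1 / (p : ℝ)) (hδ0 : 0 < δ)
    (hq : 2 * 8 ^ C.card * ((3 * P.card - 1) / δ + 2) < √(Fintype.card F)) :
    ∃ x, ∀ u, c u + x ≠ 0 ∧ ∀ l ∈ C ∪ P, (c u + x) ^ ((Fintype.card F - 1) / l) ≠ 1 := by
  classical
  by_contra! hcon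
  set q := Fintype.card F with hqdef
  set θ : ℝ := ∏ l ∈ C, (1 - 1 / (l : ℝ)) with hθ
  set s := C.card
  have hθ0 : 0 < θ := Finset.prod_pos fun l hl => by
    have h1 := (hC l hl).1.one_lt
    have h2 : (1 : ℝ) / l < 1 := by
      rw [div_lt_one (by exact_mod_cast (hC l hl).1.pos)]; exact_mod_cast h1
    linarith
  set W : F → ℝ := fun x => ∏ u, freeIndicator C (c u + x) with hW
  have hpoint : ∀ x, W x * δ ≤ ∑ p ∈ P, ∑ v, W x * balancedPowerIndicator p (c v + x) := by
    intro x
    by_cases hx : ∀ u, c u + x ≠ 0 ∧ ∀ l ∈ C, (c u + x) ^ ((q - 1) / l) ≠ 1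
    · have hW1 : W x = 1 := Finset.prod_eq_one fun u _ => if_pos (hx u)
      simp only [hW1, one_mul]
      obtain ⟨u, hu⟩ := hcon x
      obtain ⟨l, hl, hlu⟩ := hu (hx u).1
      have hlP : l ∈ P := (Finset.mem_union.1 hl).resolve_left fun h => (hx u).2 l h hlu
      have h1 : ∀ p ∈ P, ∀ v, balancedPowerIndicator p (c v + x) =
          (if (c v + x) ^ ((q - 1) / p) = 1 then (1 : ℝ) else 0) - 1 / p := by
        intro p _ v
        rw [balancedPowerIndicator, if_pos (hx v).1]
        split_ifs <;> ring
      rw [Finset.sum_congr rfl fun p hp => Finset.sum_congr rfl fun v _ => h1 p hp v]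
      simp_rw [Finset.sum_sub_distrib]
      have h2 : (1 : ℝ) ≤ ∑ p ∈ P, ∑ v, if (c v + x) ^ ((q - 1) / p) = 1 then (1 : ℝ) else 0 := by
        have h3 : ∀ p ∈ P, ∀ v ∈ (Finset.univ : Finset (Fin 3)),
            (0 : ℝ) ≤ if (c v + x) ^ ((q - 1) / p) = 1 then (1 : ℝ) else 0 := fun p _ v _ => by
          split_ifs <;> norm_num
        refine le_trans ?_ (Finset.single_le_sum (fun p hp => Finset.sum_nonneg (h3 p hp)) hlP)
        refine le_trans ?_ (Finset.single_le_sum (h3 l hlP) (Finset.mem_univ u))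
        rw [if_pos hlu]
      have h4 : ∑ p ∈ P, ∑ _v : Fin 3, 1 / (p : ℝ) = 3 * ∑ p ∈ P, 1 / (p : ℝ) := by
        rw [Finset.mul_sum]
        exact Finset.sum_congr rfl fun p _ => by simp
      rw [h4, hδ]
      linarith
    · push Not at hx
      obtain ⟨u, hu⟩ := hx
      have hW0 : W x = 0 := Finset.prod_eq_zero (Finset.mem_univ u) (by
        rw [freeIndicator, if_neg]
        rintro ⟨h1, h2⟩
        obtain ⟨l, hl, hl'⟩ := hu h1
        exact h2 l hl hl')
      simp [hW0]
  have hN : θ ^ 3 * (q - 3) - ((2 ^ s * θ) ^ 3 - θ ^ 3) * (2 * √q) ≤ ∑ x, W x := by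
    have h1 := IsCharExpansion.norm_sum_prod_sub_le hc
      (fun _ : Fin 3 => isCharExpansion_freeIndicator (F := F) hC)
    have h2 : ∑ x, ∏ u, ((freeIndicator C (c u + x) : ℝ) : ℂ) -
        (∏ _u : Fin 3, ((θ : ℝ) : ℂ)) * (Fintype.card F - 3) =
        ((∑ x, W x - θ ^ 3 * (q - 3) : ℝ) : ℂ) := by
      rw [hW]; push_cast; simp [hqdef]
    rw [← hθ, h2, Complex.norm_real, Real.norm_eq_abs, Complex.norm_real,
      Real.norm_of_nonneg hθ0.le, Finset.prod_const, Finset.prod_const, Finset.card_univ,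
      Fintype.card_fin] at h1
    have h3 := neg_abs_le (∑ x, W x - θ ^ 3 * (q - 3))
    linarith
  have hE : ∀ p ∈ P, ∀ v, ∑ x, W x * balancedPowerIndicator p (c v + x) ≤
      (2 ^ s * θ) ^ 3 * (1 - 1 / p) * (2 * √q) := by
    intro p hp v
    have h1 := IsCharExpansion.norm_sum_prod_sub_le hc
      (m := fun u => if u = v then (∏ l ∈ C, l) * p else ∏ l ∈ C, l)
      (φ := fun u g => if u = v then ((freeIndicator C g * balancedPowerIndicator p g : ℝ) : ℂ)
        else ((freeIndicator C g : ℝ) : ℂ))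
      (t := fun u => if u = v then 0 else ((θ : ℝ) : ℂ))
      (A := fun u => if u = v then 2 ^ s * θ * (1 - 1 / p) else 2 ^ s * θ) (fun u => by
        by_cases huv : u = v
        · simp only [if_pos huv]
          exact isCharExpansion_freeIndicator_mul hC (hP p hp).1 (hP p hp).2
            (Finset.disjoint_right.1 hCP hp)
        · simp only [if_neg huv]
          exact isCharExpansion_freeIndicator hC)
    have h2 : ∀ x, ∏ u, (if u = v then ((freeIndicator C (c u + x) *
        balancedPowerIndicator p (c u + x) : ℝ) : ℂ) else ((freeIndicator C (c u + x) : ℝ) : ℂ)) =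
        ((W x * balancedPowerIndicator p (c v + x) : ℝ) : ℂ) := by
      intro x
      have h3 : ∀ u, (if u = v then ((freeIndicator C (c u + x) *
          balancedPowerIndicator p (c u + x) : ℝ) : ℂ) else ((freeIndicator C (c u + x) : ℝ) : ℂ)) =
          ((freeIndicator C (c u + x) : ℝ) : ℂ) *
            (if u = v then ((balancedPowerIndicator p (c u + x) : ℝ) : ℂ) else 1) := by
        intro u; split_ifs <;> simp
      simp_rw [h3, Finset.prod_mul_distrib]
      rw [Finset.prod_ite_eq' Finset.univ v, if_pos (Finset.mem_univ v), hW]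
      push_cast
      rfl
    have h4 : ∏ u : Fin 3, (if u = v then (0 : ℂ) else ((θ : ℝ) : ℂ)) = 0 :=
      Finset.prod_eq_zero (Finset.mem_univ v) (if_pos rfl)
    have h5 : ∏ u : Fin 3, (if u = v then 2 ^ s * θ * (1 - 1 / (p : ℝ)) else 2 ^ s * θ) =
        (2 ^ s * θ) ^ 3 * (1 - 1 / p) := by
      have h6 : ∀ u, (if u = v then 2 ^ s * θ * (1 - 1 / (p : ℝ)) else 2 ^ s * θ) =
          2 ^ s * θ * (if u = v then (1 - 1 / (p : ℝ)) else 1) := by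
        intro u; split_ifs <;> ring
      rw [Finset.prod_congr rfl fun u _ => h6 u, Finset.prod_mul_distrib,
        Finset.prod_ite_eq' Finset.univ v, if_pos (Finset.mem_univ v), Finset.prod_const,
        Finset.card_univ, Fintype.card_fin]
    simp only [h2] at h1
    rw [← norm_prod, h4, norm_zero, zero_mul, sub_zero, sub_zero, h5, ← Complex.ofReal_sum,
      Complex.norm_real] at h1
    exact (Real.le_norm_self _).trans h1
  have hsum : (∑ x, W x) * δ ≤ ∑ p ∈ P, 3 * ((2 ^ s * θ) ^ 3 * (1 - 1 / (p : ℝ)) * (2 * √q)) := by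
    rw [Finset.sum_mul]
    refine (Finset.sum_le_sum fun x _ => hpoint x).trans ?_
    rw [Finset.sum_comm]
    refine Finset.sum_le_sum fun p hp => ?_
    rw [Finset.sum_comm]
    refine (Finset.sum_le_sum fun v _ => hE p hp v).trans ?_
    simp
  have h8 : ((2 : ℝ) ^ s * θ) ^ 3 = θ ^ 3 * 8 ^ s := by
    rw [mul_pow, ← pow_mul, mul_comm s 3, pow_mul]; norm_num; ring
  have hsum2 : ∑ p ∈ P, 3 * ((2 ^ s * θ) ^ 3 * (1 - 1 / (p : ℝ)) * (2 * √q)) =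
      θ ^ 3 * (8 ^ s * (2 * √q) * (3 * P.card - 1 + δ)) := by
    have : ∑ p ∈ P, 3 * ((2 ^ s * θ) ^ 3 * (1 - 1 / (p : ℝ)) * (2 * √q)) =
        3 * ((2 ^ s * θ) ^ 3) * (2 * √q) * ∑ p ∈ P, (1 - 1 / (p : ℝ)) := by
      rw [Finset.mul_sum]; exact Finset.sum_congr rfl fun p _ => by ring
    rw [this, Finset.sum_sub_distrib, Finset.sum_const, nsmul_eq_mul, mul_one, h8, hδ]
    ring
  rw [hsum2] at hsum
  have h9 : θ ^ 3 * ((q - 3 - (8 ^ s - 1) * (2 * √q)) * δ) ≤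
      θ ^ 3 * (8 ^ s * (2 * √q) * (3 * P.card - 1 + δ)) := by
    refine le_trans ?_ hsum
    have := mul_le_mul_of_nonneg_right hN hδ0.le
    rw [h8] at this
    linarith
  have h10 := le_of_mul_le_mul_left h9 (pow_pos hθ0 3)
  have hq0 : (0 : ℝ) ≤ q := Nat.cast_nonneg q
  have hsq : √(q : ℝ) ^ 2 = q := Real.sq_sqrt hq0
  set r := √(q : ℝ)
  have hr2 : 2 ≤ r * r := by
    rw [← sq, hsq]
    exact_mod_cast Fintype.one_lt_card (α := F)
  have h8s : (1 : ℝ) ≤ 8 ^ s := one_le_pow₀ (by norm_num)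
  have hcard : 3 ≤ q := by
    have := Fintype.card_le_of_injective c hc
    simpa using this
  have hr3 : 3 < 2 * r := by
    have h11 : (3 : ℝ) ≤ r ^ 2 := by rw [hsq]; exact_mod_cast hcard
    nlinarith [Real.sqrt_nonneg (q : ℝ)]
  have h12 := mul_lt_mul_of_pos_right hq hδ0
  have h13 : 2 * 8 ^ s * ((3 * (P.card : ℝ) - 1) / δ + 2) * δ =
      2 * 8 ^ s * (3 * P.card - 1 + 2 * δ) := by
    field_simp
  rw [h13] at h12
  have h14 := mul_lt_mul_of_pos_right h12 (show (0 : ℝ) < r by linarith)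
  rw [← hsq] at h10
  nlinarith

end

theorem Nat.nth_prime_le_max' {T : Finset ℕ} (hT : ∀ p ∈ T, p.Prime) (h : T.Nonempty) {n : ℕ}
    (hn : T.card = n + 1) : Nat.nth Nat.Prime n ≤ T.max' h := by
  refine Nat.lt_succ_iff.1 (Nat.nth_lt_of_lt_count ?_)
  rw [Nat.count_eq_card_filter_range, ← Nat.succ_le_iff, Nat.succ_eq_add_one, ← hn]
  exact Finset.card_le_card fun p hp => Finset.mem_filter.2
    ⟨Finset.mem_range.2 (Nat.lt_succ_of_le (T.le_max' p hp)), hT p hp⟩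

theorem Finset.exists_subset_card_eq_sum_inv_le_sum_nth_prime (k : ℕ) {n : ℕ} {T : Finset ℕ}
    (hT : ∀ p ∈ T, p.Prime) (hn : T.card = n) (hk : k ≤ n) :
    ∃ P ⊆ T, P.card = k ∧
      ∑ p ∈ P, 1 / (p : ℝ) ≤ ∑ i ∈ Finset.range k, 1 / (Nat.nth Nat.Prime (n - k + i) : ℝ) := by
  induction k generalizing n T with
  | zero => exact ⟨∅, by simp, by simp, by simp⟩
  | succ k ih =>
    obtain ⟨n, rfl⟩ : ∃ m, n = m + 1 := ⟨n - 1, by omega⟩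
    have hne : T.Nonempty := Finset.card_pos.1 (by omega)
    obtain ⟨P, hPT, hPk, hP⟩ := ih (n := n) (T := T.erase (T.max' hne))
      (fun p hp => hT p (Finset.mem_of_mem_erase hp))
      (by rw [Finset.card_erase_of_mem (T.max'_mem hne), hn]; rfl) (by omega)
    have hnot : T.max' hne ∉ P := fun h => Finset.notMem_erase _ _ (hPT h)
    refine ⟨insert (T.max' hne) P, Finset.insert_subset (T.max'_mem hne)
      (hPT.trans (Finset.erase_subset _ _)), by rw [Finset.card_insert_of_notMem hnot, hPk], ?_⟩
    rw [Finset.sum_insert hnot, Finset.sum_range_succ, add_comm, Nat.add_sub_add_right,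
      Nat.sub_add_cancel (by omega)]
    refine add_le_add hP (one_div_le_one_div_of_le ?_ ?_)
    · exact_mod_cast (Nat.prime_nth_prime n).pos
    · exact_mod_cast Nat.nth_prime_le_max' hT hne hn

theorem Finset.prod_nth_prime_le_prod {n : ℕ} {T : Finset ℕ} (hT : ∀ p ∈ T, p.Prime)
    (hn : T.card = n) : ∏ i ∈ Finset.range n, Nat.nth Nat.Prime i ≤ ∏ p ∈ T, p := by
  induction n generalizing T with
  | zero => simp [Finset.card_eq_zero.1 hn]
  | succ n ih =>
    have hne : T.Nonempty := Finset.card_pos.1 (by omega)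
    rw [Finset.prod_range_succ, ← Finset.prod_erase_mul T _ (T.max'_mem hne)]
    exact Nat.mul_le_mul (ih (fun p hp => hT p (Finset.mem_of_mem_erase hp))
      (by rw [Finset.card_erase_of_mem (T.max'_mem hne), hn]; rfl))
      (Nat.nth_prime_le_max' hT hne hn)

theorem Nat.nth_prime_eq_of_count_eq {k p : ℕ} (hp : p.Prime) (hk : Nat.count Nat.Prime p = k) :
    Nat.nth Nat.Prime k = p := by
  rw [← hk, Nat.nth_count hp]

theorem Nat.nth_prime_values :
    Nat.nth Nat.Prime 0 = 2 ∧ Nat.nth Nat.Prime 1 = 3 ∧ Nat.nth Nat.Prime 2 = 5 ∧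
    Nat.nth Nat.Prime 3 = 7 ∧ Nat.nth Nat.Prime 4 = 11 ∧ Nat.nth Nat.Prime 5 = 13 ∧
    Nat.nth Nat.Prime 6 = 17 ∧ Nat.nth Nat.Prime 7 = 19 ∧ Nat.nth Nat.Prime 8 = 23 ∧
    Nat.nth Nat.Prime 9 = 29 ∧ Nat.nth Nat.Prime 10 = 31 ∧ Nat.nth Nat.Prime 11 = 37 ∧
    Nat.nth Nat.Prime 12 = 41 ∧ Nat.nth Nat.Prime 13 = 43 ∧ Nat.nth Nat.Prime 14 = 47 ∧
    Nat.nth Nat.Prime 15 = 53 ∧ Nat.nth Nat.Prime 16 = 59 ∧ Nat.nth Nat.Prime 17 = 61 ∧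
    Nat.nth Nat.Prime 18 = 67 := by
  refine ⟨?_, ?_, ?_, ?_, ?_, ?_, ?_, ?_, ?_, ?_, ?_, ?_, ?_, ?_, ?_, ?_, ?_, ?_, ?_⟩ <;>
    exact Nat.nth_prime_eq_of_count_eq (by norm_num) (by norm_num [Nat.count_succ])

theorem le_prod_nth_prime (k : ℕ) :
    4 * 10 ^ 17 * 64 ^ k ≤ ∏ i ∈ Finset.range (15 + k), Nat.nth Nat.Prime i := by
  obtain ⟨h0, h1, h2, h3, h4, h5, h6, h7, h8, h9, h10, h11, h12, h13, h14, h15, h16, h17, h18⟩ :=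
    Nat.nth_prime_values
  by_cases hk : k < 3
  · interval_cases k <;>
    simp [Finset.prod_range_succ, h0, h1, h2, h3, h4, h5, h6, h7, h8, h9, h10, h11, h12, h13, h14,
      h15, h16]
  · obtain ⟨j, rfl⟩ : ∃ j, k = 3 + j := ⟨k - 3, by omega⟩
    clear hk
    induction j with
    | zero =>
      simp [Finset.prod_range_succ, h0, h1, h2, h3, h4, h5, h6, h7, h8, h9, h10, h11, h12, h13,
        h14, h15, h16, h17]
    | succ j ih =>
      rw [show 15 + (3 + (j + 1)) = 15 + (3 + j) + 1 by ring, Finset.prod_range_succ,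
        show 3 + (j + 1) = 3 + j + 1 by ring, pow_succ 64, ← mul_assoc]
      refine Nat.mul_le_mul ih ?_
      have : Nat.nth Nat.Prime 18 ≤ Nat.nth Nat.Prime (15 + (3 + j)) :=
        (Nat.nth_strictMono Nat.infinite_setOfPred_prime).monotone (by omega)
      omega

/-- A set of at least fourteen primes splits in such a way that the sieve inequality applies. -/
theorem exists_subset_sieve_bound {T : Finset ℕ} (hT : ∀ p ∈ T, p.Prime) (hn : 14 ≤ T.card) :
    ∃ P ⊆ T, 0 < 1 - 3 * ∑ p ∈ P, 1 / (p : ℝ) ∧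
      2 * 8 ^ (T \ P).card * ((3 * P.card - 1) / (1 - 3 * ∑ p ∈ P, 1 / (p : ℝ)) + 2) <
        √((∏ p ∈ T, p : ℕ) : ℝ) := by
  obtain ⟨h0, h1, h2, h3, h4, h5, h6, h7, h8, h9, h10, h11, h12, h13, h14, h15, h16, h17, h18⟩ :=
    Nat.nth_prime_values
  obtain ⟨P, hPT, hPk, hP⟩ :=
    Finset.exists_subset_card_eq_sum_inv_le_sum_nth_prime 8 hT rfl (by omega)
  have hprod := Finset.prod_nth_prime_le_prod hT rfl
  have hsd : (T \ P).card = T.card - 8 := by rw [Finset.card_sdiff_of_subset hPT, hPk]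
  have key : ∀ D : ℝ, 0 < D → ∑ p ∈ P, 1 / (p : ℝ) ≤ (1 - D) / 3 →
      4 * 64 ^ (T.card - 8) * (23 / D + 2) ^ 2 < ((∏ p ∈ T, p : ℕ) : ℝ) →
      ∃ P ⊆ T, 0 < 1 - 3 * ∑ p ∈ P, 1 / (p : ℝ) ∧
      2 * 8 ^ (T \ P).card * ((3 * P.card - 1) / (1 - 3 * ∑ p ∈ P, 1 / (p : ℝ)) + 2) <
        √((∏ p ∈ T, p : ℕ) : ℝ) := by
    intro D hD hs hlt
    have hδ : D ≤ 1 - 3 * ∑ p ∈ P, 1 / (p : ℝ) := by linarith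
    refine ⟨P, hPT, hD.trans_le hδ, ?_⟩
    rw [hsd, hPk]
    refine lt_of_le_of_lt (b := 2 * 8 ^ (T.card - 8) * (23 / D + 2)) ?_ ?_
    · have : ((3 : ℝ) * (8 : ℕ) - 1) / (1 - 3 * ∑ p ∈ P, 1 / (p : ℝ)) ≤ 23 / D := by
        norm_num only
        exact div_le_div_of_nonneg_left (by norm_num) hD hδ
      gcongr
    · rw [Real.lt_sqrt (by positivity)]
      refine lt_of_eq_of_lt ?_ hlt
      rw [mul_pow, mul_pow, ← pow_mul, mul_comm (T.card - 8) 2, pow_mul]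
      norm_num
  by_cases h : T.card = 14
  · rw [h] at hP hprod
    simp only [Finset.sum_range_succ, Finset.sum_range_zero, h6, h7, h8, h9, h10, h11, h12, h13,
      Nat.reduceSub, Nat.reduceAdd] at hP
    simp only [Finset.prod_range_succ, Finset.prod_range_zero, h0, h1, h2, h3, h4, h5, h6, h7, h8,
      h9, h10, h11, h12, h13] at hprod
    refine key (1109 / 10000) (by norm_num) (hP.trans (by norm_num)) ?_
    rw [h]
    refine lt_of_lt_of_le ?_ (Nat.cast_le.2 hprod)
    norm_num
  · obtain ⟨k, hk⟩ : ∃ k, T.card = 15 + k := ⟨T.card - 15, by omega⟩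
    have hsum : ∑ p ∈ P, 1 / (p : ℝ) ≤
        ∑ i ∈ Finset.range 8, 1 / (Nat.nth Nat.Prime (7 + i) : ℝ) := by
      refine hP.trans (Finset.sum_le_sum fun i _ => one_div_le_one_div_of_le ?_ ?_)
      · exact_mod_cast (Nat.prime_nth_prime _).pos
      · exact_mod_cast (Nat.nth_strictMono Nat.infinite_setOfPred_prime).monotone (by omega)
    simp only [Finset.sum_range_succ, Finset.sum_range_zero, h7, h8, h9, h10, h11, h12, h13, h14,
      Nat.reduceAdd] at hsum
    refine key (22 / 100) (by norm_num) (hsum.trans (by norm_num)) ?_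
    rw [hk] at hprod ⊢
    refine lt_of_lt_of_le ?_ (Nat.cast_le.2 ((le_prod_nth_prime k).trans hprod))
    rw [show 15 + k - 8 = 7 + k by omega, pow_add]
    push_cast
    have : (0 : ℝ) < 64 ^ k := by positivity
    nlinarith

theorem isPrimitiveElem_of_forall_pow_ne_one {F : Type*} [Field F] [Fintype F] {g : F}
    (h0 : g ≠ 0) (h : ∀ l ∈ (Fintype.card F - 1).primeFactors,
      g ^ ((Fintype.card F - 1) / l) ≠ 1) {x : F} (hx : x ≠ 0) : ∃ k : ℕ, g ^ k = x := by
  classical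
  have hpos : 0 < Fintype.card F - 1 := Nat.sub_pos_of_lt Fintype.one_lt_card
  have horder : orderOf (Units.mk0 g h0) = Nat.card Fˣ := by
    rw [Nat.card_eq_fintype_card, Fintype.card_units]
    refine orderOf_eq_of_pow_and_pow_div_prime hpos ?_ fun p hp hpd hg => ?_
    · exact Units.ext (FiniteField.pow_card_sub_one_eq_one g h0)
    · refine h p (Nat.mem_primeFactors.2 ⟨hp, hpd, hpos.ne'⟩) ?_
      simpa using congrArg Units.val hg
  have htop := Subgroup.eq_top_of_card_eq (Subgroup.zpowers (Units.mk0 g h0))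
    (by rw [Nat.card_zpowers, horder])
  obtain ⟨k, hk⟩ := mem_powers_iff_mem_zpowers.2 (htop ▸ Subgroup.mem_top (Units.mk0 x hx))
  exact ⟨k, by simpa using congrArg Units.val hk⟩

theorem natCast_fin_three_injective {F : Type*} [Field F] [Fintype F] (hodd : Odd (Fintype.card F)) :
    Function.Injective fun u : Fin 3 => ((u : ℕ) : F) := by
  have h2 : (2 : F) ≠ 0 := by
    refine Ring.two_ne_zero fun h => ?_
    have := FiniteField.even_card_of_char_two h
    have := Nat.odd_iff.1 hodd
    omega
  have h1 : (1 : F) ≠ 2 := fun h => one_ne_zero (α := F) (by linear_combination -h)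
  intro a b hab
  fin_cases a <;> fin_cases b <;> simp_all [eq_comm]

/-- For `q` an odd prime power with `ω(q-1) ≥ 14`, the field `𝔽_q` contains three
consecutive primitive elements. -/
theorem three_consecutive_primitives_of_omega_ge_14 (q : ℕ) (hq : IsPrimePow q)
    (hodd : Odd q) (homega : 14 ≤ (q - 1).primeFactors.card)
    (F : Type*) [Field F] [Fintype F] (hF : Fintype.card F = q) :
    HasConsecutivePrimitives F 3 := by
  subst hF
  have hinj := natCast_fin_three_injective (F := F) hodd
  have hT : ∀ p ∈ (Fintype.card F - 1).primeFactors, p.Prime ∧ p ∣ Fintype.card F - 1 :=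
    fun p hp => ⟨Nat.prime_of_mem_primeFactors hp, Nat.dvd_of_mem_primeFactors hp⟩
  obtain ⟨P, hPT, hδ, hlt⟩ := exists_subset_sieve_bound (fun p hp => (hT p hp).1) homega
  have hle : ∏ p ∈ (Fintype.card F - 1).primeFactors, p ≤ Fintype.card F :=
    (Nat.le_of_dvd (Nat.sub_pos_of_lt Fintype.one_lt_card) (Nat.prod_primeFactors_dvd _)).trans
      (Nat.sub_le _ _)
  obtain ⟨x, hx⟩ := exists_forall_pow_ne_one hinj sdiff_disjoint
    (fun l hl => hT l (sdiff_subset hl)) (fun l hl => hT l (hPT hl)) rfl hδ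
    (hlt.trans_le (Real.sqrt_le_sqrt (Nat.cast_le.2 hle)))
  rw [sdiff_union_of_subset hPT] at hx
  refine ⟨x, fun k hk y hy => ?_, fun i hi j hj hij => ?_⟩
  · obtain ⟨h0, h1⟩ := hx ⟨k, hk⟩
    rw [add_comm]
    exact isPrimitiveElem_of_forall_pow_ne_one h0 h1 hy
  · exact Fin.mk.inj (hinj (a₁ := ⟨i, hi⟩) (a₂ := ⟨j, hj⟩) (add_left_cancel hij))
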